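/- arXiv:2511.09517 — 7 statements merged into one kernel-verified Lean document; each statement's English description precedes it below -/
import Mathlib

section
/- Let A ⊆ {1,…,N'} be nonempty with #A = a, and let f : A → {1,…,N} be a function with range {j_1 < … < j_m}; set N_i := #f^{-1}(j_i) for 1 ≤ i ≤ m. Then the probability of the coalescent event that 𝔭(u_j) = f(j) for every j ∈ A equals E[∏_{i=1}^m (ν_{j_i})_{N_i}] / (N')_a. -/
open MeasureTheory Finset
open scoped ENNReal

/-- The parent map associated with an offspring vector `v`: the individuals
`0, 1, …` are partitioned into consecutive blocks of sizes `v 0, v 1, …`, and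
`parentMap v c` is the index of the block containing individual `c`. -/
noncomputable def parentMap (v : ℕ → ℕ) (c : ℕ) : ℕ :=
  sInf {i : ℕ | c < ∑ j ∈ Finset.range (i + 1), v j}

/-- The value (as a natural number) of a permutation of `Fin M` at position `i < M`,
and `0` otherwise.  Used to read off the entries `u_i` of a random permutation. -/
def permVal {M : ℕ} (e : Equiv.Perm (Fin M)) (i : ℕ) : ℕ :=
  if h : i < M then (e ⟨i, h⟩ : Fin M) else 0

lemma cea_count {α : Type*} [Fintype α] [DecidableEq α] (g f : α → ℕ) (T : Finset ℕ)
    (A : Finset α) (hT : ∀ j ∈ A, f j ∈ T) :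
    #{e : Equiv.Perm α | ∀ j ∈ A, g (e j) = f j}
      = (Fintype.card α - #A).factorial *
        ∏ i ∈ T, (#{c : α | g c = i}).descFactorial (#{j ∈ A | f j = i}) := by
  induction A using Finset.induction_on with
  | empty => simp [Fintype.card_perm]
  | insert j₀ A hj ih =>
    have ih := ih (fun j hj => hT j (Finset.mem_insert_of_mem hj))
    have hlt : #A < Fintype.card α := by
      have h1 := Finset.card_le_univ (insert j₀ A)
      rw [Finset.card_insert_of_notMem hj] at h1
      omega
    have hj₀T : f j₀ ∈ T := hT j₀ (Finset.mem_insert_self _ _)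
    set C : Finset (Equiv.Perm α) := {e : Equiv.Perm α | ∀ j ∈ A, g (e j) = f j} with hC
    set D : Finset (Equiv.Perm α) := {e : Equiv.Perm α | ∀ j ∈ insert j₀ A, g (e j) = f j} with hD
    have key : (Fintype.card α - #A) * #D
        = #C * (#{c : α | g c = f j₀} - #{j ∈ A | f j = f j₀}) := by
      have h1 : ∀ k ∈ Aᶜ, #{e ∈ C | g (e k) = f j₀} = #D := by
        intro k hk
        rw [Finset.mem_compl] at hk
        have hsw : ∀ j ∈ A, Equiv.swap k j₀ j = j := fun j hjA =>
          Equiv.swap_apply_of_ne_of_ne (fun h => hk (h ▸ hjA)) (fun h => hj (h ▸ hjA))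
        apply Finset.card_bij' (fun e _ => e * Equiv.swap k j₀) (fun e _ => e * Equiv.swap k j₀)
        · intro e he
          simp only [hC, hD, Finset.mem_filter, Finset.mem_univ, true_and,
            Finset.mem_insert] at he ⊢
          rintro j (rfl | hjA)
          · simpa using he.2
          · simpa [hsw j hjA] using he.1 j hjA
        · intro e he
          simp only [hC, hD, Finset.mem_filter, Finset.mem_univ, true_and,
            Finset.mem_insert] at he ⊢
          refine ⟨fun j hjA => ?_, ?_⟩
          · simpa [hsw j hjA] using he j (Or.inr hjA)
          · simpa using he j₀ (Or.inl rfl)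
        · intro e _
          simp [mul_assoc]
        · intro e _
          simp [mul_assoc]
      have h2 : ∀ e ∈ C, #{k ∈ Aᶜ | g (e k) = f j₀}
          = #{c : α | g c = f j₀} - #{j ∈ A | f j = f j₀} := by
        intro e he
        simp only [hC, Finset.mem_filter, Finset.mem_univ, true_and] at he
        have h3 : #{c : α | g c = f j₀} = #{k : α | g (e k) = f j₀} := by
          symm
          apply Finset.card_equiv e
          simp
        rw [h3, ← Finset.card_sdiff_of_subset]
        · congr 1
          ext k
          simp only [Finset.mem_filter, Finset.mem_compl, Finset.mem_sdiff, Finset.mem_univ,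
            true_and]
          constructor
          · rintro ⟨a, b⟩
            exact ⟨b, fun h => a h.1⟩
          · rintro ⟨a, b⟩
            exact ⟨fun h => b ⟨h, (he k h).symm.trans a⟩, a⟩
        · intro k hk
          simp only [Finset.mem_filter, Finset.mem_univ, true_and] at hk ⊢
          rw [he k hk.1, hk.2]
      have h4 := Finset.sum_card_bipartiteAbove_eq_sum_card_bipartiteBelow
        (s := Aᶜ) (t := C) (fun k e => g (e k) = f j₀)
      simp only [Finset.bipartiteAbove, Finset.bipartiteBelow] at h4
      rw [Finset.sum_congr rfl h1, Finset.sum_congr rfl h2] at h4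
      simpa [Finset.card_compl] using h4
    have hprod : ∏ i ∈ T, (#{c : α | g c = i}).descFactorial (#{j ∈ insert j₀ A | f j = i})
        = (#{c : α | g c = f j₀} - #{j ∈ A | f j = f j₀}) *
          ∏ i ∈ T, (#{c : α | g c = i}).descFactorial (#{j ∈ A | f j = i}) := by
      rw [← Finset.mul_prod_erase T _ hj₀T, ← Finset.mul_prod_erase T _ hj₀T, ← mul_assoc]
      congr 1
      · rw [Finset.filter_insert, if_pos rfl, Finset.card_insert_of_notMem (by simp [hj]),
          Nat.descFactorial_succ]
      · apply Finset.prod_congr rfl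
        intro i hi
        rw [Finset.filter_insert, if_neg (Finset.ne_of_mem_erase hi).symm]
    obtain ⟨m, hm⟩ : ∃ m, Fintype.card α - #A = m + 1 :=
      ⟨Fintype.card α - #A - 1, by omega⟩
    have hm' : Fintype.card α - #(insert j₀ A) = m := by
      rw [Finset.card_insert_of_notMem hj]; omega
    rw [hprod, hm']
    rw [ih, hm, Nat.factorial_succ] at key
    apply Nat.eq_of_mul_eq_mul_left (Nat.succ_pos m)
    rw [key, Nat.succ_eq_add_one]
    ring

lemma cea_parent_iff (v : ℕ → ℕ) (c k : ℕ) :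
    parentMap v c = k ↔
      ((c < ∑ j ∈ Finset.range (k + 1), v j) ∧
        ∀ i, i < k → ¬ c < ∑ j ∈ Finset.range (i + 1), v j) ∨
      (k = 0 ∧ ∀ i, ¬ c < ∑ j ∈ Finset.range (i + 1), v j) := by
  unfold parentMap
  by_cases hne : {i : ℕ | c < ∑ j ∈ Finset.range (i + 1), v j}.Nonempty
  · constructor
    · rintro rfl
      exact Or.inl ⟨Nat.sInf_mem hne, fun i hi =>
        Nat.notMem_of_lt_sInf (s := {i : ℕ | c < ∑ j ∈ Finset.range (i + 1), v j}) hi⟩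
    · rintro (⟨h1, h2⟩ | ⟨_, h⟩)
      · apply le_antisymm
          (Nat.sInf_le (s := {i : ℕ | c < ∑ j ∈ Finset.range (i + 1), v j}) h1)
        by_contra hlt
        exact h2 _ (not_le.mp hlt) (Nat.sInf_mem hne)
      · obtain ⟨i, hi⟩ := hne
        exact absurd hi (h i)
  · have he := Set.not_nonempty_iff_eq_empty.mp hne
    have hall : ∀ i, ¬ c < ∑ j ∈ Finset.range (i + 1), v j := fun i hi => hne ⟨i, hi⟩
    rw [he, Nat.sInf_empty]
    constructor
    · rintro rfl
      exact Or.inr ⟨rfl, hall⟩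
    · rintro (⟨h1, _⟩ | ⟨h, _⟩)
      · exact absurd h1 (hall k)
      · exact h.symm

lemma cea_parent_meas (c k : ℕ) : MeasurableSet {v : ℕ → ℕ | parentMap v c = k} := by
  have hb : ∀ i : ℕ, MeasurableSet {v : ℕ → ℕ | c < ∑ j ∈ Finset.range (i + 1), v j} := by
    intro i
    apply measurableSet_lt measurable_const
    exact Finset.measurable_sum _ (fun j _ => measurable_pi_apply j)
  have he : {v : ℕ → ℕ | parentMap v c = k} =
      ({v : ℕ → ℕ | c < ∑ j ∈ Finset.range (k + 1), v j} ∩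
        ⋂ i : ℕ, ⋂ _ : i < k, {v : ℕ → ℕ | c < ∑ j ∈ Finset.range (i + 1), v j}ᶜ) ∪
      ({_v : ℕ → ℕ | k = 0} ∩
        ⋂ i : ℕ, {v : ℕ → ℕ | c < ∑ j ∈ Finset.range (i + 1), v j}ᶜ) := by
    ext v
    simp only [Set.mem_setOf_eq, cea_parent_iff, Set.mem_union, Set.mem_inter_iff,
      Set.mem_iInter, Set.mem_compl_iff]
  rw [he]
  exact ((hb k).inter (MeasurableSet.iInter fun i => MeasurableSet.iInter fun _ =>
    (hb i).compl)).union ((MeasurableSet.const _).inter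
      (MeasurableSet.iInter fun i => (hb i).compl))

lemma cea_block (v : ℕ → ℕ) (N N' i : ℕ) (hs : ∑ j ∈ Finset.range N, v j = N') (hi : i < N) :
    #{c : Fin N' | parentMap v c = i} = v i := by
  have hmono : Monotone fun i => ∑ j ∈ Finset.range i, v j := fun a b h =>
    Finset.sum_le_sum_of_subset (Finset.range_mono h)
  have hle : ∑ j ∈ Finset.range (i + 1), v j ≤ N' := hs ▸ hmono hi
  have hiff : ∀ c : ℕ, c < N' → (parentMap v c = i ↔
      c ∈ Finset.Ico (∑ j ∈ Finset.range i, v j) (∑ j ∈ Finset.range (i + 1), v j)) := by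
    intro c hc
    rw [cea_parent_iff, Finset.mem_Ico]
    constructor
    · rintro (⟨h1, h2⟩ | ⟨_, h⟩)
      · refine ⟨?_, h1⟩
        cases i with
        | zero => simp
        | succ m => exact not_lt.mp (h2 m (Nat.lt_succ_self m))
      · obtain ⟨m, rfl⟩ : ∃ m, N = m + 1 := ⟨N - 1, by omega⟩
        exact absurd (hs ▸ hc) (h m)
    · rintro ⟨h1, h2⟩
      exact Or.inl ⟨h2, fun l hl => not_lt.mpr ((hmono hl).trans h1)⟩
  have : #{c : Fin N' | parentMap v c = i}
      = #(Finset.Ico (∑ j ∈ Finset.range i, v j) (∑ j ∈ Finset.range (i + 1), v j)) := by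
    apply Finset.card_bij (fun (c : Fin N') _ => (c : ℕ))
    · intro c hc
      exact (hiff c c.2).1 (by simpa using hc)
    · intro a _ b _ h
      exact Fin.ext h
    · intro b hb
      have hbN : b < N' := (Finset.mem_Ico.mp hb).2.trans_le hle
      exact ⟨⟨b, hbN⟩, by simpa using (hiff b hbN).2 hb, rfl⟩
  rw [this, Nat.card_Ico, Finset.sum_range_succ]
  omega

lemma cea_count' (v : ℕ → ℕ) (N N' : ℕ) (hs : ∑ j ∈ Finset.range N, v j = N')
    (A : Finset ℕ) (hAsub : A ⊆ Finset.range N') (f : ℕ → ℕ) (hf : ∀ j ∈ A, f j < N) :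
    #{e : Equiv.Perm (Fin N') | ∀ j ∈ A, parentMap v (permVal e j) = f j}
      = (N' - #A).factorial *
        ∏ i ∈ A.image f, (v i).descFactorial (#{j ∈ A | f j = i}) := by
  have hlt : ∀ j ∈ A, j < N' := fun j hj => Finset.mem_range.mp (hAsub hj)
  set B : Finset (Fin N') := {x : Fin N' | (x : ℕ) ∈ A} with hB
  have hcard : ∀ p : ℕ → Prop, ∀ [DecidablePred p], #(B.filter fun x : Fin N' => p (x : ℕ)) = #{j ∈ A | p j} := by
    intro p _
    apply Finset.card_bij (fun (c : Fin N') _ => (c : ℕ))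
    · intro c hc
      simpa [hB] using hc
    · intro a _ b _ h
      exact Fin.ext h
    · intro b hb
      exact ⟨⟨b, hlt b (Finset.mem_filter.mp hb).1⟩, by simpa [hB] using hb, rfl⟩
  have hBA : #B = #A := by simpa using hcard (fun _ => True)
  have h := cea_count (fun c : Fin N' => parentMap v c) (fun x : Fin N' => f x) (A.image f) B
    (fun j hj => Finset.mem_image_of_mem f (by simpa [hB] using hj))
  rw [hBA, Fintype.card_fin] at h
  refine Eq.trans ?_ (h.trans ?_)
  · apply congrArg Finset.card
    ext e
    simp only [Finset.mem_filter, Finset.mem_univ, true_and, hB]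
    constructor
    · intro h j hj
      simpa [permVal] using h j hj
    · intro h j hj
      simpa [permVal, hlt j hj] using h ⟨j, hlt j hj⟩ hj
  · congr 1
    apply Finset.prod_congr rfl
    intro i hi
    obtain ⟨j, hj, rfl⟩ := Finset.mem_image.mp hi
    rw [cea_block v N N' _ hs (hf j hj), hcard (fun x => f x = f j)]

/-- For a nonempty `A ⊆ {0,…,N'-1}` and `f : A → {0,…,N-1}` with
range `{j_1,…,j_m}` and multiplicities `N_i = #f⁻¹(j_i)`, the probability of the
coalescent event `{∀ j ∈ A, 𝔭(u_j) = f j}` equals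
`E[∏_i (ν_{j_i})_{N_i}] / (N')_{#A}`. -/
theorem coalescent_event_probability
    {Ω : Type*} [MeasurableSpace Ω] (P : Measure Ω) [IsProbabilityMeasure P]
    (N N' : ℕ) (hN : 0 < N) (hN' : 0 < N')
    (ν : Ω → ℕ → ℕ) (hνmeas : Measurable ν)
    (hsum : ∀ᵐ ω ∂P, ∑ i ∈ Finset.range N, ν ω i = N')
    (hexch : ∀ π : Equiv.Perm (Fin N),
      Measure.map (fun ω => fun i : Fin N => ν ω (π i)) P
        = Measure.map (fun ω => fun i : Fin N => ν ω i) P)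
    (σ : Ω → Equiv.Perm (Fin N'))
    (hσmeas : ∀ e, MeasurableSet {ω | σ ω = e})
    (hσunif : ∀ e : Equiv.Perm (Fin N'),
      P {ω | σ ω = e} = 1 / (Nat.factorial N' : ℝ≥0∞))
    (hindep : ∀ (e : Equiv.Perm (Fin N')) (S : Set (ℕ → ℕ)), MeasurableSet S →
      P ({ω | σ ω = e} ∩ ν ⁻¹' S) = P {ω | σ ω = e} * P (ν ⁻¹' S))
    (A : Finset ℕ) (hA : A.Nonempty) (hAsub : A ⊆ Finset.range N')
    (f : ℕ → ℕ) (hf : ∀ j ∈ A, f j < N) :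
    (P {ω | ∀ j ∈ A, parentMap (ν ω) (permVal (σ ω) j) = f j}).toReal
      = (∫ ω, ∏ i ∈ A.image f,
            ((ν ω i).descFactorial ((A.filter fun j => f j = i).card) : ℝ) ∂P)
        / (N'.descFactorial A.card : ℝ) := by
  classical
  set S : Equiv.Perm (Fin N') → Set (ℕ → ℕ) :=
    fun e => {v | ∀ j ∈ A, parentMap v (permVal e j) = f j} with hS
  have hSm : ∀ e, MeasurableSet (S e) := by
    intro e
    simp only [hS, Set.ofPred_forall]
    exact Finset.measurableSet_biInter A fun j _ => cea_parent_meas _ _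
  have hev : {ω | ∀ j ∈ A, parentMap (ν ω) (permVal (σ ω) j) = f j}
      = ⋃ e ∈ (Finset.univ : Finset (Equiv.Perm (Fin N'))), ({ω | σ ω = e} ∩ ν ⁻¹' S e) := by
    ext ω
    simp [hS]
  have hfac : (N'.factorial : ℝ) ≠ 0 := by exact_mod_cast N'.factorial_ne_zero
  have h1 : (P {ω | ∀ j ∈ A, parentMap (ν ω) (permVal (σ ω) j) = f j}).toReal
      = (1 / (N'.factorial : ℝ)) * ∑ e, P.real (ν ⁻¹' S e) := by
    rw [hev, measure_biUnion_finset]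
    · rw [ENNReal.toReal_sum (fun e _ => measure_ne_top _ _), Finset.mul_sum]
      apply Finset.sum_congr rfl
      intro e _
      rw [hindep e _ (hSm e), hσunif, ENNReal.toReal_mul]
      simp [Measure.real]
    · intro a _ b _ hab
      apply Set.disjoint_left.mpr
      rintro ω ⟨ha, _⟩ ⟨hb, _⟩
      exact hab (ha.symm.trans hb)
    · intro e _
      exact (hσmeas e).inter (hνmeas (hSm e))
  have h2 : ∑ e, P.real (ν ⁻¹' S e)
      = ∫ ω, ∑ e, (ν ⁻¹' S e).indicator (fun _ => (1 : ℝ)) ω ∂P := by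
    rw [integral_finsetSum]
    · apply Finset.sum_congr rfl
      intro e _
      exact (integral_indicator_one (hνmeas (hSm e))).symm
    · intro e _
      exact (integrable_const _).indicator (hνmeas (hSm e))
  have h3 : ∫ ω, ∑ e, (ν ⁻¹' S e).indicator (fun _ => (1 : ℝ)) ω ∂P
      = ((N' - #A).factorial : ℝ) * ∫ ω, ∏ i ∈ A.image f,
            ((ν ω i).descFactorial ((A.filter fun j => f j = i).card) : ℝ) ∂P := by
    rw [← integral_const_mul]
    apply integral_congr_ae
    filter_upwards [hsum] with ω hω
    have hc := cea_count' (ν ω) N N' hω A hAsub f hf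
    have hc' := congrArg (Nat.cast : ℕ → ℝ) hc
    push_cast at hc'
    rw [← hc', Finset.card_filter]
    push_cast
    apply Finset.sum_congr rfl
    intro e _
    simp [Set.indicator_apply, hS]
  have hAle : #A ≤ N' := by simpa using Finset.card_le_card hAsub
  have h4 : ((N' - #A).factorial : ℝ) * (N'.descFactorial #A : ℝ) = N'.factorial := by
    exact_mod_cast Nat.factorial_mul_descFactorial hAle
  have h5 : (N'.descFactorial #A : ℝ) ≠ 0 := fun h => hfac (by rw [← h4, h, mul_zero])
  rw [h1, h2, h3, eq_div_iff h5, ← h4]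
  rw [← h4] at hfac
  have h6 := left_ne_zero_of_mul hfac
  field_simp
end

section
/- For all integers 1 ≤ l ≤ m ≤ N' with m − l + 1 ≤ N, the probability of the event {𝔭(u_1) = 𝔭(u_2) = ⋯ = 𝔭(u_l)} ∩ {𝔭(u_l), 𝔭(u_{l+1}), …, 𝔭(u_m) are pairwise distinct} equals ((N)_{m−l+1} / (N')_m) · E[(ν_1)_l · ν_2 ν_3 ⋯ ν_{m−l+1}] (the product ν_2⋯ν_{m−l+1} being 1 when m = l). -/
open MeasureTheory Finset
open scoped ENNReal

open Classical in
lemma cnt_emb {A B I : Type} [Fintype A] [Fintype B] [Fintype I] (p : A → B) (g : I → B) :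
    Nat.card {x : I ↪ A // ∀ i, p (x i) = g i}
      = ∏ j, (Nat.card {a // p a = j}).descFactorial (Nat.card {i // g i = j}) := by
  have : {x : I ↪ A // ∀ i, p (x i) = g i} ≃ ∀ j : B, ({i // g i = j} ↪ {a // p a = j}) :=
    { toFun := fun x j => ⟨fun i => ⟨x.1 i.1, (x.2 i.1).trans i.2⟩, fun a b h => by
        apply Subtype.ext
        apply x.1.injective
        exact congrArg Subtype.val h⟩
      invFun := fun F => ⟨⟨fun i => (F (g i) ⟨i, rfl⟩).1, fun a b h => by
        have h' : (F (g a) ⟨a, rfl⟩).1 = (F (g b) ⟨b, rfl⟩).1 := h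
        have hg : g a = g b := by
          rw [← (F (g a) ⟨a, rfl⟩).2, ← (F (g b) ⟨b, rfl⟩).2, h']
        have key : ∀ j (ha : g a = j) (hb : g b = j), (F j ⟨a, ha⟩).1 = (F j ⟨b, hb⟩).1 → a = b := by
          intro j ha hb hh
          exact congrArg Subtype.val ((F j).injective (Subtype.ext hh))
        apply key (g b) hg rfl
        rw [← h']
        have : ∀ j (ha : g a = j), (F j ⟨a, ha⟩).1 = (F (g a) ⟨a, rfl⟩).1 := by
          rintro j rfl; rfl
        exact this _ _⟩, fun i => (F (g i) ⟨i, rfl⟩).2⟩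
      left_inv := fun x => by ext; rfl
      right_inv := fun F => by
        funext j
        ext ⟨i, hi⟩
        subst hi
        rfl }
  rw [Nat.card_congr this]
  simp only [Nat.card_eq_fintype_card]
  rw [Fintype.card_pi]
  simp only [Fintype.card_embedding_eq]

open Classical in
lemma cnt_perm {m r : ℕ} {B : Type} (p : Fin (m + r) → B) (g : Fin m → B) :
    Nat.card {e : Equiv.Perm (Fin (m + r)) // ∀ i : Fin m, p (e (Fin.castAdd r i)) = g i}
      = Nat.card {x : Fin m ↪ Fin (m + r) // ∀ i, p (x i) = g i} * r.factorial := by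
  let E : Equiv.Perm (Fin (m + r)) ≃ Σ f : Fin m ↪ Fin (m+r), Fin r ↪ ↥(Set.range f)ᶜ :=
    (Equiv.embeddingEquivOfFinite (Fin (m+r))).symm.trans
      ((Equiv.embeddingCongr finSumFinEquiv.symm (Equiv.refl _)).trans
        Equiv.sumEmbeddingEquivSigmaEmbeddingRestricted)
  have hE : ∀ e i, (E e).1 i = e (Fin.castAdd r i) := by
    intro e i
    rfl
  have E2 : {e : Equiv.Perm (Fin (m + r)) // ∀ i : Fin m, p (e (Fin.castAdd r i)) = g i} ≃
     Σ f : {x : Fin m ↪ Fin (m + r) // ∀ i, p (x i) = g i}, Fin r ↪ ↥(Set.range f.1)ᶜ :=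
    (E.subtypeEquiv (q := fun y => ∀ i, p (y.1 i) = g i) (fun e => by simp only [hE])).trans
     (Equiv.subtypeSigmaEquiv (fun f : Fin m ↪ Fin (m+r) => Fin r ↪ ↥(Set.range f)ᶜ) (fun x => ∀ i, p (x i) = g i))
  rw [Nat.card_congr E2]
  simp only [Nat.card_eq_fintype_card]
  rw [Fintype.card_sigma]
  have : ∀ f : Fin m ↪ Fin (m+r), Fintype.card (Fin r ↪ ↥(Set.range f)ᶜ) = r.factorial := by
    intro f
    rw [Fintype.card_embedding_eq, Fintype.card_compl_set, Set.card_range_of_injective f.injective]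
    simp [Nat.descFactorial_self]
  simp only [this]
  simp

lemma pm_iff (v : ℕ → ℕ) (c i : ℕ) (h : c < ∑ j ∈ range (i + 1), v j) (j : ℕ) :
    parentMap v c = j ↔ (∑ t ∈ range j, v t ≤ c ∧ c < ∑ t ∈ range (j + 1), v t) := by
  have hm : Monotone (fun n => ∑ t ∈ range n, v t) := fun a b hab =>
    Finset.sum_le_sum_of_subset (Finset.range_mono hab)
  have hne : {i : ℕ | c < ∑ j ∈ Finset.range (i + 1), v j}.Nonempty := ⟨i, h⟩
  have h1 : c < ∑ t ∈ range (parentMap v c + 1), v t := Nat.sInf_mem hne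
  have h2 : ∑ t ∈ range (parentMap v c), v t ≤ c := by
    rcases Nat.eq_zero_or_pos (parentMap v c) with h0 | h0
    · simp [h0]
    · by_contra hcon
      push Not at hcon
      have : parentMap v c ≤ parentMap v c - 1 := by
        apply Nat.sInf_le
        show c < _
        rwa [Nat.sub_add_cancel h0]
      omega
  constructor
  · rintro rfl; exact ⟨h2, h1⟩
  · rintro ⟨h3, h4⟩
    by_contra hne
    rcases lt_or_gt_of_ne hne with hlt | hlt
    · have := hm (show parentMap v c + 1 ≤ j from hlt)
      simp only at this
      omega
    · have := hm (show j + 1 ≤ parentMap v c from hlt)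
      simp only at this
      omega

lemma pm_lt (v : ℕ → ℕ) (N c : ℕ) (hN : 0 < N) (h : c < ∑ j ∈ range N, v j) : parentMap v c < N := by
  have : parentMap v c ≤ N - 1 := by
    apply Nat.sInf_le
    show c < _
    rwa [Nat.sub_add_cancel hN]
  omega

lemma pm_card (v : ℕ → ℕ) (N M : ℕ) (hN : 0 < N) (h : ∑ j ∈ range N, v j = M) (j : ℕ) (hj : j < N) :
    Nat.card {c : Fin M // parentMap v c = j} = v j := by
  have hm : Monotone (fun n => ∑ t ∈ range n, v t) := fun a b hab =>
    Finset.sum_le_sum_of_subset (Finset.range_mono hab)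
  have h1 : ∑ t ∈ range (j+1), v t ≤ M := h ▸ hm hj
  have key : ∀ c : Fin M, parentMap v c = j ↔ (∑ t ∈ range j, v t ≤ c ∧ (c : ℕ) < ∑ t ∈ range (j + 1), v t) := by
    intro c
    apply pm_iff v c (N-1)
    rw [Nat.sub_add_cancel hN, h]; exact c.2
  have E : {c : Fin M // parentMap v c = j} ≃ Finset.Ico (∑ t ∈ range j, v t) (∑ t ∈ range (j + 1), v t) :=
    { toFun := fun c => ⟨c.1, by rw [Finset.mem_Ico]; exact (key c.1).1 c.2⟩
      invFun := fun c => ⟨⟨c.1, lt_of_lt_of_le (Finset.mem_Ico.1 c.2).2 h1⟩, (key _).2 (Finset.mem_Ico.1 c.2)⟩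
      left_inv := fun c => rfl
      right_inv := fun c => rfl }
  rw [Nat.card_congr E, Nat.card_eq_fintype_card, Fintype.card_coe, Nat.card_Ico, Finset.sum_range_succ]
  omega

lemma pm_meas (c : ℕ) : Measurable (fun v : ℕ → ℕ => parentMap v c) := by
  apply measurable_of_Iic
  intro n
  have : (fun v : ℕ → ℕ => parentMap v c) ⁻¹' Set.Iic n =
    (⋃ i : ℕ, ⋃ (_ : i ≤ n), {v | c < ∑ j ∈ range (i+1), v j}) ∪ ⋂ i : ℕ, {v | c < ∑ j ∈ range (i+1), v j}ᶜ := by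
    ext v
    simp only [Set.mem_preimage, Set.mem_Iic, Set.mem_union, Set.mem_iUnion, Set.mem_ofPred_eq, Set.mem_iInter, Set.mem_compl_iff]
    constructor
    · intro h
      by_cases hne : ∃ i, c < ∑ j ∈ range (i+1), v j
      · left
        exact ⟨_, h, Nat.sInf_mem (s := {i : ℕ | c < ∑ j ∈ Finset.range (i + 1), v j}) hne⟩
      · right; push Not at hne; intro i; simpa using hne i
    · rintro (⟨i, hi, h⟩ | h)
      · exact le_trans (Nat.sInf_le (s := {i : ℕ | c < ∑ j ∈ Finset.range (i + 1), v j}) h) hi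
      · have : {i : ℕ | c < ∑ j ∈ Finset.range (i + 1), v j} = ∅ := by
          ext i; simpa using h i
        simp [parentMap, this]
  rw [this]
  have hS : ∀ i, MeasurableSet {v : ℕ → ℕ | c < ∑ j ∈ range (i+1), v j} := fun i =>
    measurableSet_lt measurable_const (by fun_prop)
  exact (MeasurableSet.iUnion fun i => MeasurableSet.iUnion fun _ => hS i).union
    (MeasurableSet.iInter fun i => (hS i).compl)

def Ev {M : ℕ} (l m : ℕ) (v : ℕ → ℕ) (e : Equiv.Perm (Fin M)) : Prop :=
  (∀ i < l, parentMap v (permVal e i) = parentMap v (permVal e 0))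
          ∧ ∀ i j, l - 1 ≤ i → i < j → j < m →
              parentMap v (permVal e i) ≠ parentMap v (permVal e j)

lemma Ev_meas {M : ℕ} (l m : ℕ) (e : Equiv.Perm (Fin M)) : MeasurableSet {v | Ev l m v e} := by
  unfold Ev
  have h : ∀ i j, MeasurableSet {v : ℕ → ℕ | parentMap v i = parentMap v j} := fun i j =>
    measurableSet_eq_fun (pm_meas _) (pm_meas _)
  simp only [Set.ofPred_and, Set.ofPred_forall]
  refine (MeasurableSet.iInter fun i => MeasurableSet.iInter fun _ => h _ _).inter ?_
  refine MeasurableSet.iInter fun i => MeasurableSet.iInter fun j => MeasurableSet.iInter fun _ => MeasurableSet.iInter fun _ => MeasurableSet.iInter fun _ => (h _ _).compl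

/-- weight -/
def Wt {k : ℕ} (l : ℕ) (w : Fin (k + 1) → ℕ) : ℕ :=
  (w 0).descFactorial l * ∏ i : Fin k, w i.succ

/-- pattern -/
def pat (l k : ℕ) (i : Fin (l + k)) (hl : 1 ≤ l) : Fin (k + 1) := ⟨i - (l - 1), by omega⟩

lemma Ev_iff (l k r N : ℕ) (hl : 1 ≤ l) (hN : 0 < N) (v : ℕ → ℕ)
    (h : ∑ j ∈ range N, v j = l + k + r) (e : Equiv.Perm (Fin (l + k + r))) :
    Ev l (l + k) v e ↔ ∃ f : Fin (k+1) ↪ Fin N, ∀ i : Fin (l + k),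
      parentMap v (e (Fin.castAdd r i)) = f (pat l k i hl) := by
  have hp : ∀ i : Fin (l + k), permVal e i = e (Fin.castAdd r i) := by
    intro i
    have : (i : ℕ) < l + k + r := by omega
    simp only [permVal, this, dif_pos]; rfl
  have hlt : ∀ i : Fin (l+k), parentMap v (permVal e i) < N := by
    intro i
    apply pm_lt _ _ _ hN
    rw [hp, h]; exact Fin.is_lt _
  simp only [← hp]
  constructor
  · rintro ⟨h1, h2⟩
    refine ⟨⟨fun t => ⟨parentMap v (permVal e (t + (l - 1))), hlt ⟨t + (l - 1), by omega⟩⟩, ?_⟩, ?_⟩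
    · intro a b hab
      simp only [Fin.mk.injEq] at hab
      by_contra hne
      rcases lt_or_gt_of_ne hne with hh | hh
      · exact h2 (a + (l-1)) (b + (l-1)) (by omega) (by omega) (by omega) hab
      · exact h2 (b + (l-1)) (a + (l-1)) (by omega) (by omega) (by omega) hab.symm
    · intro i
      show _ = parentMap v (permVal e (i - (l - 1) + (l - 1)))
      by_cases hi : (i : ℕ) < l
      · rw [h1 i hi, ← h1 (i - (l-1) + (l-1)) (by omega)]
      · rw [Nat.sub_add_cancel (by omega)]
  · rintro ⟨f, hf⟩
    constructor
    · intro i hi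
      have a := hf ⟨i, by omega⟩
      have b := hf ⟨0, by omega⟩
      simp only at a b
      rw [a, b]
      congr 2
      simp only [pat]
      ext; simp only; omega
    · intro i j hi hij hj heq
      have a := hf ⟨i, by omega⟩
      have b := hf ⟨j, by omega⟩
      simp only at a b
      rw [a, b] at heq
      have := f.injective (Fin.ext heq)
      simp only [pat, Fin.mk.injEq] at this
      omega

open Classical in
lemma pat_card (l k : ℕ) (hl : 1 ≤ l) (t : Fin (k + 1)) :
    Nat.card {i : Fin (l + k) // pat l k i hl = t} = if t = 0 then l else 1 := by
  split_ifs with ht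
  · subst ht
    have E : {i : Fin (l + k) // pat l k i hl = 0} ≃ Fin l :=
      { toFun := fun i => ⟨i.1, by have := congrArg Fin.val i.2; simp [pat] at this; omega⟩
        invFun := fun i => ⟨⟨i, by omega⟩, by ext; simp [pat]; omega⟩
        left_inv := fun i => rfl
        right_inv := fun i => rfl }
    rw [Nat.card_congr E, Nat.card_fin]
  · rw [Nat.card_eq_fintype_card, Fintype.card_eq_one_iff]
    have ht' : (t : ℕ) ≠ 0 := fun h => ht (Fin.ext h)
    refine ⟨⟨⟨t + (l - 1), by omega⟩, by ext; simp [pat]⟩, ?_⟩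
    rintro ⟨i, hi⟩
    have := congrArg Fin.val hi
    simp only [pat] at this
    ext; simp only; omega

open Classical in
lemma cnt_f (l k r N : ℕ) (hl : 1 ≤ l) (hN : 0 < N) (v : ℕ → ℕ)
    (h : ∑ j ∈ range N, v j = l + k + r) (f : Fin (k + 1) ↪ Fin N) :
    Nat.card {e : Equiv.Perm (Fin (l + k + r)) // ∀ i : Fin (l + k),
      parentMap v (e (Fin.castAdd r i)) = f (pat l k i hl)} = Wt l (fun t => v (f t)) * r.factorial := by
  let p : Fin (l + k + r) → Fin N := fun c => ⟨parentMap v c, pm_lt _ _ _ hN (by rw [h]; exact c.2)⟩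
  have h1 := cnt_perm (m := l + k) (r := r) p (fun i => f (pat l k i hl))
  have h0 := cnt_emb p (fun i => f (pat l k i hl))
  have h2 : ∀ e : Equiv.Perm (Fin (l + k + r)), (∀ i : Fin (l + k),
      parentMap v (e (Fin.castAdd r i)) = f (pat l k i hl)) ↔ ∀ i : Fin (l + k), p (e (Fin.castAdd r i)) = f (pat l k i hl) := by
    intro e
    simp only [Fin.ext_iff, p]
  rw [Nat.card_congr (Equiv.subtypeEquivRight h2), h1, h0]
  congr 1
  have h3 : ∀ j : Fin N, Nat.card {a // p a = j} = v j := by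
    intro j
    rw [← pm_card v N _ hN h j j.2]
    apply Nat.card_congr
    apply Equiv.subtypeEquivRight
    intro a
    simp only [Fin.ext_iff, p]
  simp only [h3]
  rw [← Finset.prod_subset (Finset.subset_univ (Finset.univ.map f)), Finset.prod_map, Fin.prod_univ_succ]
  · simp only [f.injective.eq_iff, pat_card]
    simp [Wt, Fin.succ_ne_zero]
  · intro j _ hj
    have : IsEmpty {i : Fin (l + k) // f (pat l k i hl) = j} := by
      constructor
      rintro ⟨i, hi⟩
      exact hj (by simp [← hi])
    rw [Nat.card_eq_fintype_card, Fintype.card_eq_zero, Nat.descFactorial_zero]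

open Classical in
lemma cnt_Ev (l k r N : ℕ) (hl : 1 ≤ l) (hN : 0 < N) (v : ℕ → ℕ)
    (h : ∑ j ∈ range N, v j = l + k + r) :
    (∑ e : Equiv.Perm (Fin (l + k + r)), if Ev l (l + k) v e then (1:ℝ) else 0)
     = r.factorial * ∑ f : Fin (k + 1) ↪ Fin N, (Wt l (fun t => v (f t)) : ℝ) := by
  have h1 : ∀ e : Equiv.Perm (Fin (l + k + r)), (if Ev l (l + k) v e then (1:ℝ) else 0)
      = ∑ f : Fin (k + 1) ↪ Fin N, if (∀ i : Fin (l + k),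
      parentMap v (e (Fin.castAdd r i)) = f (pat l k i hl)) then (1:ℝ) else 0 := by
    intro e
    rw [Ev_iff l k r N hl hN v h]
    split_ifs with hE
    · obtain ⟨f, hf⟩ := hE
      rw [Finset.sum_eq_single f, if_pos hf]
      · intro f' _ hne
        rw [if_neg]
        intro hf'
        apply hne
        ext t
        have hi : pat l k ⟨t + (l-1), by omega⟩ hl = t := by ext; simp [pat]
        rw [← hi, ← hf, ← hf']
      · simp
    · symm
      apply Finset.sum_eq_zero
      intro f _
      rw [if_neg]
      intro hf; exact hE ⟨f, hf⟩
  simp only [h1]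
  rw [Finset.sum_comm, Finset.mul_sum]
  apply Finset.sum_congr rfl
  intro f _
  rw [Finset.sum_boole, ← Fintype.card_subtype, ← Nat.card_eq_fintype_card, cnt_f l k r N hl hN v h f]
  push_cast; ring

lemma exch_int {Ω : Type*} [MeasurableSpace Ω] (P : Measure Ω) 
    (N : ℕ) (ν : Ω → ℕ → ℕ) (hνmeas : Measurable ν)
    (hexch : ∀ π : Equiv.Perm (Fin N),
      Measure.map (fun ω => fun i : Fin N => ν ω (π i)) P
        = Measure.map (fun ω => fun i : Fin N => ν ω i) P) (l k : ℕ) (hk : k + 1 ≤ N)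
    (f : Fin (k + 1) ↪ Fin N) :
    ∫ ω, (Wt l (fun t => ν ω (f t)) : ℝ) ∂P = ∫ ω, (Wt l (fun t : Fin (k + 1) => ν ω t) : ℝ) ∂P := by
  have := Equiv.Perm.isMultiplyPretransitive (Fin N) (k + 1)
  obtain ⟨π, hπ⟩ := MulAction.exists_smul_eq (Equiv.Perm (Fin N)) (Fin.castLEEmb hk) f
  have hπ' : ∀ t, π (Fin.castLE hk t) = f t := fun t => by rw [← hπ]; rfl
  let G : (Fin N → ℕ) → ℝ := fun w => (Wt l (fun t => w (Fin.castLE hk t)) : ℝ)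
  have hG : Measurable G := measurable_of_countable G
  have hm : ∀ i, Measurable (fun ω => ν ω i) := fun i => (measurable_pi_apply i).comp hνmeas
  have h1 : ∫ ω, G (fun i => ν ω (π i)) ∂P = ∫ ω, G (fun i => ν ω i) ∂P := by
    rw [← integral_map (f := G) (φ := fun ω => fun i : Fin N => ν ω (π i)) (measurable_pi_lambda _ fun i => hm _).aemeasurable
      hG.aestronglyMeasurable, hexch, integral_map (measurable_pi_lambda _ fun i => hm _).aemeasurable
      hG.aestronglyMeasurable]
  simp only [G, hπ'] at h1
  exact h1

/-- For `1 ≤ l ≤ m ≤ N'` with `m - l + 1 ≤ N`, the probability that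
`𝔭(u_1) = ⋯ = 𝔭(u_l)` and `𝔭(u_l), 𝔭(u_{l+1}), …, 𝔭(u_m)` are pairwise distinct equals
`((N)_{m-l+1} / (N')_m) · E[(ν_1)_l · ν_2 ⋯ ν_{m-l+1}]`.
(Indices of `u` and `ν` are shifted to be `0`-based.) -/
theorem coalescent_merge_and_distinct_probability
    {Ω : Type*} [MeasurableSpace Ω] (P : Measure Ω) [IsProbabilityMeasure P]
    (N N' : ℕ) (hN : 0 < N) (hN' : 0 < N')
    (ν : Ω → ℕ → ℕ) (hνmeas : Measurable ν)
    (hsum : ∀ᵐ ω ∂P, ∑ i ∈ Finset.range N, ν ω i = N')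
    (hexch : ∀ π : Equiv.Perm (Fin N),
      Measure.map (fun ω => fun i : Fin N => ν ω (π i)) P
        = Measure.map (fun ω => fun i : Fin N => ν ω i) P)
    (σ : Ω → Equiv.Perm (Fin N'))
    (hσmeas : ∀ e, MeasurableSet {ω | σ ω = e})
    (hσunif : ∀ e : Equiv.Perm (Fin N'),
      P {ω | σ ω = e} = 1 / (Nat.factorial N' : ℝ≥0∞))
    (hindep : ∀ (e : Equiv.Perm (Fin N')) (S : Set (ℕ → ℕ)), MeasurableSet S →
      P ({ω | σ ω = e} ∩ ν ⁻¹' S) = P {ω | σ ω = e} * P (ν ⁻¹' S))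
    (l m : ℕ) (hl : 1 ≤ l) (hlm : l ≤ m) (hmN' : m ≤ N') (hmlN : m - l + 1 ≤ N) :
    (P {ω | (∀ i < l, parentMap (ν ω) (permVal (σ ω) i)
              = parentMap (ν ω) (permVal (σ ω) 0))
          ∧ ∀ i j, l - 1 ≤ i → i < j → j < m →
              parentMap (ν ω) (permVal (σ ω) i)
                ≠ parentMap (ν ω) (permVal (σ ω) j)}).toReal
      = ((N.descFactorial (m - l + 1) : ℝ) / (N'.descFactorial m : ℝ))
        * ∫ ω, ((ν ω 0).descFactorial l : ℝ)
            * ∏ i ∈ Finset.Ico 1 (m - l + 1), (ν ω i : ℝ) ∂P := by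
  classical
  obtain ⟨k, rfl⟩ := Nat.exists_eq_add_of_le hlm
  obtain ⟨r, rfl⟩ := Nat.exists_eq_add_of_le hmN'
  rw [Nat.add_sub_cancel_left] at *
  have hm : ∀ i, Measurable (fun ω => ν ω i) := fun i => (measurable_pi_apply i).comp hνmeas
  change (P {ω | Ev l (l + k) (ν ω) (σ ω)}).toReal = _
  have hset : {ω | Ev l (l + k) (ν ω) (σ ω)}
      = ⋃ e ∈ (Finset.univ : Finset (Equiv.Perm (Fin (l + k + r)))), ({ω | σ ω = e} ∩ ν ⁻¹' {v | Ev l (l+k) v e}) := by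
    ext ω
    simp
  have hP : P {ω | Ev l (l + k) (ν ω) (σ ω)}
      = ∑ e : Equiv.Perm (Fin (l + k + r)), 1 / ((l + k + r).factorial : ℝ≥0∞) * P (ν ⁻¹' {v | Ev l (l+k) v e}) := by
    rw [hset, measure_biUnion_finset]
    · apply Finset.sum_congr rfl
      intro e _
      rw [hindep e _ (Ev_meas l (l+k) e), hσunif]
    · intro e _ e' _ hne
      apply Set.disjoint_left.2
      rintro ω ⟨h1, _⟩ ⟨h2, _⟩
      exact hne (h1.symm.trans h2)
    · intro e _
      exact (hσmeas e).inter (hνmeas (Ev_meas l (l+k) e))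
  have hreal : ∀ e : Equiv.Perm (Fin (l + k + r)), (P (ν ⁻¹' {v | Ev l (l+k) v e})).toReal
      = ∫ ω, (if Ev l (l + k) (ν ω) e then (1:ℝ) else 0) ∂P := by
    intro e
    have h1 := integral_indicator_one (μ := P) (hνmeas (Ev_meas l (l+k) e))
    rw [← Measure.real, ← h1]
    rfl
  have hI : ∀ e : Equiv.Perm (Fin (l + k + r)),
      Integrable (fun ω => if Ev l (l + k) (ν ω) e then (1:ℝ) else 0) P := by
    intro e
    exact (integrable_const (1:ℝ)).indicator (hνmeas (Ev_meas l (l+k) e))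
  have hW : ∀ f : Fin (k + 1) ↪ Fin N, Integrable (fun ω => (Wt l (fun t => ν ω (f t)) : ℝ)) P := by
    intro f
    have hmeas : Measurable (fun ω => (Wt l (fun t => ν ω (f t)) : ℝ)) :=
      (measurable_of_countable (fun w : Fin (k + 1) → ℕ => (Wt l w : ℝ))).comp
        (measurable_pi_lambda _ fun t => hm _)
    apply Integrable.of_bound hmeas.aestronglyMeasurable (((l + k + r) ^ l * ∏ _i : Fin k, (l + k + r) : ℕ) : ℝ)
    filter_upwards [hsum] with ω hω
    have hle : ∀ j : Fin N, ν ω j ≤ l + k + r := by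
      intro j
      rw [← hω]
      exact Finset.single_le_sum (f := fun i => ν ω i) (fun _ _ => Nat.zero_le _) (Finset.mem_range.2 j.2)
    rw [Real.norm_of_nonneg (Nat.cast_nonneg _), Nat.cast_le]
    unfold Wt
    apply Nat.mul_le_mul
    · exact (Nat.descFactorial_le_pow _ _).trans (Nat.pow_le_pow_left (hle _) _)
    · exact Finset.prod_le_prod' fun i _ => hle _
  rw [hP, ENNReal.toReal_sum (fun e _ => by finiteness)]
  simp only [ENNReal.toReal_mul, hreal]
  rw [← Finset.mul_sum, ← integral_finsetSum _ (fun e _ => hI e)]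
  have hae : ∫ ω, (∑ e : Equiv.Perm (Fin (l + k + r)), if Ev l (l + k) (ν ω) e then (1:ℝ) else 0) ∂P
      = ∫ ω, (r.factorial * ∑ f : Fin (k + 1) ↪ Fin N, (Wt l (fun t => ν ω (f t)) : ℝ)) ∂P := by
    apply integral_congr_ae
    filter_upwards [hsum] with ω hω
    exact cnt_Ev l k r N hl hN (ν ω) hω
  rw [hae, integral_const_mul, integral_finsetSum _ (fun f _ => hW f)]
  simp only [exch_int P N ν hνmeas hexch l k hmlN]
  rw [Finset.sum_const, Finset.card_univ, Fintype.card_embedding_eq, Fintype.card_fin, Fintype.card_fin, nsmul_eq_mul]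
  have hWt : ∀ ω, (Wt l (fun t : Fin (k + 1) => ν ω t) : ℝ) = ((ν ω 0).descFactorial l : ℝ)
            * ∏ i ∈ Finset.Ico 1 (k + 1), (ν ω i : ℝ) := by
    intro ω
    rw [Finset.prod_Ico_eq_prod_range, Finset.prod_range]
    simp [Wt, add_comm]
  simp only [hWt]
  have hfac : ((l + k + r).factorial : ℝ) = r.factorial * (l + k + r).descFactorial (l + k) := by
    rw [← Nat.factorial_mul_descFactorial (Nat.le_add_right (l + k) r), Nat.add_sub_cancel_left]
    push_cast; rfl
  have h1 : (r.factorial : ℝ) ≠ 0 := by positivity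
  have h2 : ((l + k + r).descFactorial (l + k) : ℝ) ≠ 0 := by
    intro h0
    rw [h0, mul_zero] at hfac
    exact (Nat.cast_ne_zero.2 (Nat.factorial_ne_zero _)) hfac
  rw [ENNReal.toReal_div, ENNReal.toReal_natCast, hfac]
  simp only [ENNReal.toReal_one]
  field_simp
end

section
/- If N ≥ 2 and N' ≥ 4, then P(𝔭(u_1) = 𝔭(u_2) ≠ 𝔭(u_3) = 𝔭(u_4)) = ((N)_2 / (N')_4) · E[(ν_1)_2 (ν_2)_2]. -/
open MeasureTheory Finset
open scoped ENNReal

def permEmb {M : ℕ} (hM : 4 ≤ M) (e : Equiv.Perm (Fin M)) : Fin 4 ↪ Fin M :=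
  (Fin.castLEEmb hM).trans e.toEmbedding

lemma fiber_card {M : ℕ} (hM : 4 ≤ M) (f : Fin 4 ↪ Fin M) :
    #{e : Equiv.Perm (Fin M) | permEmb hM e = f}
      = #{e : Equiv.Perm (Fin M) | permEmb hM e = Fin.castLEEmb hM} := by
  obtain ⟨g, hg⟩ := Equiv.Perm.exists_smul_eq_embedding f (Fin.castLEEmb hM)
  refine Finset.card_bij (fun e _ => g * e) ?_ ?_ ?_
  · intro e he
    simp only [mem_filter, mem_univ, true_and] at he ⊢
    rw [← hg, ← he]
    ext i; simp [permEmb, Function.Embedding.smul_apply]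
  · intro a _ b _ h
    exact mul_left_cancel h
  · intro b hb
    simp only [mem_filter, mem_univ, true_and] at hb
    refine ⟨g⁻¹ * b, ?_, by simp⟩
    simp only [mem_filter, mem_univ, true_and]
    have : f = g⁻¹ • permEmb hM b := by rw [hb, ← hg]; simp
    rw [this]
    ext i; simp [permEmb, Function.Embedding.smul_apply]

lemma perm_count {M : ℕ} (hM : 4 ≤ M) (R : (Fin 4 ↪ Fin M) → Prop) [DecidablePred R] :
    #{e : Equiv.Perm (Fin M) | R (permEmb hM e)} * M.descFactorial 4
      = #{f : Fin 4 ↪ Fin M | R f} * M.factorial := by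
  have key : ∀ (R : (Fin 4 ↪ Fin M) → Prop) [DecidablePred R],
      #{e : Equiv.Perm (Fin M) | R (permEmb hM e)} = #{f : Fin 4 ↪ Fin M | R f} *
        #{e : Equiv.Perm (Fin M) | permEmb hM e = Fin.castLEEmb hM} := by
    intro R _
    rw [Finset.card_eq_sum_card_fiberwise (f := permEmb hM) (t := {f | R f})]
    · rw [← smul_eq_mul, ← Finset.sum_const]
      refine Finset.sum_congr rfl fun f hf => ?_
      rw [← fiber_card hM f, Finset.filter_filter]
      congr 1
      ext e
      simp only [mem_filter, mem_univ, true_and] at hf ⊢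
      constructor
      · exact fun h => h.2
      · intro h; rw [h]; exact ⟨hf, rfl⟩
    · intro e he; simpa using he
  have h1 := key (fun _ => True)
  simp only [Finset.filter_true, Finset.card_univ, Fintype.card_perm, Fintype.card_fin,
    Fintype.card_embedding_eq] at h1
  rw [key R, h1]; ring

def inBlk (v : ℕ → ℕ) (i c : ℕ) : Prop :=
  ∑ j ∈ Finset.range i, v j ≤ c ∧ c < ∑ j ∈ Finset.range (i + 1), v j

instance (v : ℕ → ℕ) (i c : ℕ) : Decidable (inBlk v i c) := by unfold inBlk; infer_instance

lemma pre_mono (v : ℕ → ℕ) : Monotone (fun i => ∑ j ∈ Finset.range i, v j) := by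
  intro a b h
  exact Finset.sum_le_sum_of_subset (Finset.range_mono h)

lemma parentMap_eq_iff {v : ℕ → ℕ} {N c : ℕ} (hc : c < ∑ j ∈ Finset.range N, v j) (i : ℕ) :
    parentMap v c = i ↔ inBlk v i c := by
  have hN : N ≠ 0 := by rintro rfl; simp at hc
  have hne : {i : ℕ | c < ∑ j ∈ Finset.range (i + 1), v j}.Nonempty :=
    ⟨N - 1, by simpa [Nat.sub_add_cancel (Nat.one_le_iff_ne_zero.2 hN)] using hc⟩
  have h1 : inBlk v (parentMap v c) c := by
    refine ⟨?_, Nat.sInf_mem hne⟩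
    by_contra hlt
    push Not at hlt
    rcases hp : parentMap v c with _ | k
    · rw [hp] at hlt; simp at hlt
    · rw [hp] at hlt
      have : k ∉ {i : ℕ | c < ∑ j ∈ Finset.range (i + 1), v j} :=
        Nat.notMem_of_lt_sInf (by change k < parentMap v c; omega)
      exact this hlt
  constructor
  · rintro rfl; exact h1
  · intro h2
    by_contra hne
    rcases Nat.lt_or_gt_of_ne hne with h | h
    · have := pre_mono v (Nat.succ_le_of_lt h)
      have := h1.2; have := h2.1
      simp only [Nat.succ_eq_add_one] at *
      omega
    · have := pre_mono v (Nat.succ_le_of_lt h)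
      have := h1.1; have := h2.2
      simp only [Nat.succ_eq_add_one] at *
      omega

lemma parentMap_lt {v : ℕ → ℕ} {N c : ℕ} (hc : c < ∑ j ∈ Finset.range N, v j) :
    parentMap v c < N := by
  have h := (parentMap_eq_iff hc _).1 rfl
  by_contra hle
  have := pre_mono v (not_lt.1 hle)
  have := h.1
  simp only at *
  omega

lemma block_card {v : ℕ → ℕ} {N M i : ℕ} (hs : ∑ j ∈ Finset.range N, v j = M) (hi : i < N) :
    #{c : Fin M | parentMap v c = i} = v i := by
  have hle : ∑ j ∈ Finset.range (i + 1), v j ≤ M := hs ▸ pre_mono v (Nat.succ_le_of_lt hi)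
  have : (({c : Fin M | parentMap v c = i} : Finset (Fin M)).map Fin.valEmbedding)
      = Finset.Ico (∑ j ∈ Finset.range i, v j) (∑ j ∈ Finset.range (i + 1), v j) := by
    ext c
    simp only [mem_map, mem_filter, mem_univ, true_and, Fin.valEmbedding_apply, mem_Ico]
    constructor
    · rintro ⟨a, ha, rfl⟩
      exact (parentMap_eq_iff (N := N) (by rw [hs]; exact a.2) i).1 ha
    · intro h
      have hc : c < M := by omega
      exact ⟨⟨c, hc⟩, (parentMap_eq_iff (N := N) (by rw [hs]; exact hc) i).2 h, rfl⟩
  rw [← Finset.card_map, this, Nat.card_Ico, Finset.sum_range_succ]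
  omega

lemma emb_count_ij {v : ℕ → ℕ} {N M i j : ℕ} (hs : ∑ j ∈ Finset.range N, v j = M)
    (hi : i < N) (hj : j < N) (hij : i ≠ j) :
    #{f : Fin 4 ↪ Fin M | parentMap v (f 0) = i ∧ parentMap v (f 1) = i ∧
        parentMap v (f 2) = j ∧ parentMap v (f 3) = j}
      = (v i).descFactorial 2 * (v j).descFactorial 2 := by
  have h2 : ∀ i < N, ((({c : Fin M | parentMap v c = i} : Finset (Fin M))).offDiag).card
      = (v i).descFactorial 2 := by
    intro i hi
    rw [Finset.offDiag_card, block_card hs hi]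
    rcases v i with _ | n
    · simp
    · simp [Nat.descFactorial]; rw [Nat.mul_comm n]; rw [← Nat.mul_sub_one]; simp
  rw [← h2 i hi, ← h2 j hj, ← Finset.card_product]
  refine Finset.card_bij (fun f _ => ((f 0, f 1), (f 2, f 3))) ?_ ?_ ?_
  · intro f hf
    simp only [mem_filter, mem_univ, true_and, mem_product, mem_offDiag] at hf ⊢
    refine ⟨⟨hf.1, hf.2.1, fun h => ?_⟩, hf.2.2.1, hf.2.2.2, fun h => ?_⟩ <;>
    · have := f.injective h
      simp at this
  · intro f _ g _ h
    simp only [Prod.mk.injEq] at h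
    ext k
    fin_cases k <;> simp [h]
  · rintro ⟨⟨a, b⟩, ⟨c, d⟩⟩ h
    simp only [mem_filter, mem_univ, true_and, mem_product, mem_offDiag] at h
    obtain ⟨⟨ha, hb, hab⟩, hc, hd, hcd⟩ := h
    have hne : ∀ x y : Fin M, parentMap v x = i → parentMap v y = j → x ≠ y := by
      rintro x y hx hy rfl; exact hij (hx.symm.trans hy)
    have hac := hne _ _ ha hc
    have had := hne _ _ ha hd
    have hbc := hne _ _ hb hc
    have hbd := hne _ _ hb hd
    refine ⟨⟨![a, b, c, d], ?_⟩, ?_, ?_⟩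
    · intro x y hxy
      fin_cases x <;> fin_cases y <;> simp_all
    · simp only [mem_filter, mem_univ, true_and]; exact ⟨ha, hb, hc, hd⟩
    · rfl

lemma emb_count {v : ℕ → ℕ} {N M : ℕ} (hs : ∑ j ∈ Finset.range N, v j = M) :
    #{f : Fin 4 ↪ Fin M | parentMap v (f 0) = parentMap v (f 1) ∧
        parentMap v (f 2) = parentMap v (f 3) ∧ parentMap v (f 0) ≠ parentMap v (f 2)}
      = ∑ p ∈ (Finset.range N).offDiag,
          (v p.1).descFactorial 2 * (v p.2).descFactorial 2 := by
  rw [Finset.card_eq_sum_card_fiberwise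
    (f := fun f : Fin 4 ↪ Fin M => (parentMap v (f 0), parentMap v (f 2)))
    (t := (Finset.range N).offDiag)]
  · refine Finset.sum_congr rfl ?_
    rintro ⟨i, j⟩ h
    simp only [mem_offDiag, mem_range] at h
    rw [← emb_count_ij hs h.1 h.2.1 h.2.2, Finset.filter_filter]
    congr 1
    ext f
    simp only [mem_filter, mem_univ, true_and, Prod.mk.injEq]
    constructor
    · rintro ⟨⟨h1, h2, h3⟩, h4, h5⟩
      exact ⟨h4, h1 ▸ h4, h5, h2 ▸ h5⟩
    · rintro ⟨h1, h2, h3, h4⟩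
      refine ⟨⟨by rw [h1, h2], by rw [h3, h4], by rw [h1, h3]; exact h.2.2⟩, h1, h3⟩
  · intro f hf
    simp only [coe_filter, mem_univ, true_and, Set.mem_ofPred_eq] at hf
    simp only [mem_coe, mem_offDiag, mem_range]
    exact ⟨parentMap_lt (hs ▸ (f 0).2), parentMap_lt (hs ▸ (f 2).2), hf.2.2⟩

def evSet {M : ℕ} (N : ℕ) (e : Equiv.Perm (Fin M)) : Set (ℕ → ℕ) :=
  {v | ∃ p ∈ (Finset.range N).offDiag, inBlk v p.1 (permVal e 0) ∧ inBlk v p.1 (permVal e 1) ∧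
    inBlk v p.2 (permVal e 2) ∧ inBlk v p.2 (permVal e 3)}

lemma measurableSet_inBlk (i c : ℕ) : MeasurableSet {v : ℕ → ℕ | inBlk v i c} := by
  have h : ∀ i, Measurable (fun v : ℕ → ℕ => ∑ j ∈ Finset.range i, v j) := fun i =>
    Finset.measurable_sum _ (fun j _ => measurable_pi_apply j)
  exact (measurableSet_le (h i) measurable_const).inter (measurableSet_lt measurable_const (h (i+1)))

lemma measurableSet_evSet {M : ℕ} (N : ℕ) (e : Equiv.Perm (Fin M)) :
    MeasurableSet (evSet N e) := by
  have : evSet N e = ⋃ p ∈ (Finset.range N).offDiag,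
      ({v | inBlk v p.1 (permVal e 0)} ∩ ({v | inBlk v p.1 (permVal e 1)} ∩
    ({v | inBlk v p.2 (permVal e 2)} ∩ {v | inBlk v p.2 (permVal e 3)}))) := by
    ext v
    simp only [Set.mem_iUnion, exists_prop]
    rfl
  rw [this]
  refine Finset.measurableSet_biUnion _ fun p _ => ?_
  exact (measurableSet_inBlk _ _).inter ((measurableSet_inBlk _ _).inter
    ((measurableSet_inBlk _ _).inter (measurableSet_inBlk _ _)))

lemma permVal_lt {M : ℕ} (hM : 4 ≤ M) (e : Equiv.Perm (Fin M)) (i : ℕ) : permVal e i < M := by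
  unfold permVal
  split_ifs
  · exact Fin.is_lt _
  · omega

lemma mem_evSet {v : ℕ → ℕ} {N M : ℕ} (hM : 4 ≤ M) (hs : ∑ j ∈ Finset.range N, v j = M)
    (e : Equiv.Perm (Fin M)) :
    v ∈ evSet N e ↔ (parentMap v (permVal e 0) = parentMap v (permVal e 1)
          ∧ parentMap v (permVal e 2) = parentMap v (permVal e 3)
          ∧ parentMap v (permVal e 0) ≠ parentMap v (permVal e 2)) := by
  have hlt : ∀ i, permVal e i < ∑ j ∈ Finset.range N, v j := fun i => hs ▸ permVal_lt hM e i
  have hb : ∀ i k, inBlk v k (permVal e i) ↔ parentMap v (permVal e i) = k :=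
    fun i k => (parentMap_eq_iff (hlt i) k).symm
  change (∃ p ∈ (Finset.range N).offDiag, inBlk v p.1 (permVal e 0) ∧ inBlk v p.1 (permVal e 1) ∧
    inBlk v p.2 (permVal e 2) ∧ inBlk v p.2 (permVal e 3)) ↔ _
  simp only [hb, mem_offDiag, mem_range]
  constructor
  · rintro ⟨p, ⟨_, _, hp⟩, h0, h1, h2, h3⟩
    exact ⟨h0.trans h1.symm, h2.trans h3.symm, by rw [h0, h2]; exact hp⟩
  · rintro ⟨h1, h2, h3⟩
    exact ⟨(_, _), ⟨parentMap_lt (hlt 0), parentMap_lt (hlt 2), h3⟩, rfl, h1.symm, rfl, h2.symm⟩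

open Classical in
lemma evSet_count {v : ℕ → ℕ} {N M : ℕ} (hM : 4 ≤ M) (hs : ∑ j ∈ Finset.range N, v j = M) :
    #{e : Equiv.Perm (Fin M) | v ∈ evSet N e} * M.descFactorial 4
      = (∑ p ∈ (Finset.range N).offDiag,
          (v p.1).descFactorial 2 * (v p.2).descFactorial 2) * M.factorial := by
  rw [← emb_count hs]
  convert perm_count hM (fun f => parentMap v (f 0) = parentMap v (f 1) ∧
        parentMap v (f 2) = parentMap v (f 3) ∧ parentMap v (f 0) ≠ parentMap v (f 2)) using 3
  ext e
  simp only [mem_filter, mem_univ, true_and]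
  rw [mem_evSet hM hs]
  have h : ∀ i : Fin 4, ((permEmb hM e i : Fin M) : ℕ) = permVal e i := by
    intro i
    rw [permVal, dif_pos (by omega)]
    rfl
  rw [h 0, h 1, h 2, h 3]
  rfl

lemma exch_integral {Ω : Type*} [MeasurableSpace Ω] (P : Measure Ω)
    (N : ℕ) (hN : 2 ≤ N) (ν : Ω → ℕ → ℕ) (hνmeas : Measurable ν)
    (hexch : ∀ π : Equiv.Perm (Fin N),
      Measure.map (fun ω => fun i : Fin N => ν ω (π i)) P
        = Measure.map (fun ω => fun i : Fin N => ν ω i) P)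
    (i j : ℕ) (hi : i < N) (hj : j < N) (hij : i ≠ j) :
    ∫ ω, ((ν ω i).descFactorial 2 : ℝ) * ((ν ω j).descFactorial 2 : ℝ) ∂P
      = ∫ ω, ((ν ω 0).descFactorial 2 : ℝ) * ((ν ω 1).descFactorial 2 : ℝ) ∂P := by
  obtain ⟨π, hπ⟩ := Equiv.Perm.exists_extending_pair
    (![⟨0, by omega⟩, ⟨1, by omega⟩] : Fin 2 → Fin N) ![⟨i, hi⟩, ⟨j, hj⟩]
    (by intro x y h; fin_cases x <;> fin_cases y <;> simp_all)
    (by intro x y h; fin_cases x <;> fin_cases y <;> simp_all)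
  have h0 : π ⟨0, by omega⟩ = ⟨i, hi⟩ := by simpa using hπ 0
  have h1 : π ⟨1, by omega⟩ = ⟨j, hj⟩ := by simpa using hπ 1
  let g : (Fin N → ℕ) → ℝ := fun w =>
    ((w ⟨0, by omega⟩).descFactorial 2 : ℝ) * ((w ⟨1, by omega⟩).descFactorial 2 : ℝ)
  have hg : Measurable g := Measurable.of_discrete
  have hm : ∀ τ : Fin N → Fin N, Measurable (fun ω => fun i : Fin N => ν ω (τ i)) := fun τ =>
    measurable_pi_lambda _ fun k => (measurable_pi_apply _).comp hνmeas
  have e1 := integral_map (μ := P) (hm π).aemeasurable hg.aestronglyMeasurable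
  have e2 := integral_map (μ := P) (hm id).aemeasurable hg.aestronglyMeasurable
  simp only [id] at e2
  rw [hexch π, e2] at e1
  simp only [g, h0, h1] at e1
  exact e1.symm

/-- If `N ≥ 2` and `N' ≥ 4`, then
`P(𝔭(u_1) = 𝔭(u_2) ≠ 𝔭(u_3) = 𝔭(u_4)) = ((N)_2 / (N')_4) · E[(ν_1)_2 (ν_2)_2]`.
(Indices of `u` and `ν` are shifted to be `0`-based.) -/
theorem coalescent_two_pairs_probability
    {Ω : Type*} [MeasurableSpace Ω] (P : Measure Ω) [IsProbabilityMeasure P]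
    (N N' : ℕ) (hN : 2 ≤ N) (hN' : 4 ≤ N')
    (ν : Ω → ℕ → ℕ) (hνmeas : Measurable ν)
    (hsum : ∀ᵐ ω ∂P, ∑ i ∈ Finset.range N, ν ω i = N')
    (hexch : ∀ π : Equiv.Perm (Fin N),
      Measure.map (fun ω => fun i : Fin N => ν ω (π i)) P
        = Measure.map (fun ω => fun i : Fin N => ν ω i) P)
    (σ : Ω → Equiv.Perm (Fin N'))
    (hσmeas : ∀ e, MeasurableSet {ω | σ ω = e})
    (hσunif : ∀ e : Equiv.Perm (Fin N'),
      P {ω | σ ω = e} = 1 / (Nat.factorial N' : ℝ≥0∞))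
    (hindep : ∀ (e : Equiv.Perm (Fin N')) (S : Set (ℕ → ℕ)), MeasurableSet S →
      P ({ω | σ ω = e} ∩ ν ⁻¹' S) = P {ω | σ ω = e} * P (ν ⁻¹' S)) :
    (P {ω | parentMap (ν ω) (permVal (σ ω) 0) = parentMap (ν ω) (permVal (σ ω) 1)
          ∧ parentMap (ν ω) (permVal (σ ω) 2) = parentMap (ν ω) (permVal (σ ω) 3)
          ∧ parentMap (ν ω) (permVal (σ ω) 0)
              ≠ parentMap (ν ω) (permVal (σ ω) 2)}).toReal
      = ((N.descFactorial 2 : ℝ) / (N'.descFactorial 4 : ℝ))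
        * ∫ ω, ((ν ω 0).descFactorial 2 : ℝ) * ((ν ω 1).descFactorial 2 : ℝ) ∂P := by
  classical
  have hset : ∀ᵐ ω ∂P, (ω ∈ {ω | parentMap (ν ω) (permVal (σ ω) 0) = parentMap (ν ω) (permVal (σ ω) 1)
          ∧ parentMap (ν ω) (permVal (σ ω) 2) = parentMap (ν ω) (permVal (σ ω) 3)
          ∧ parentMap (ν ω) (permVal (σ ω) 0)
              ≠ parentMap (ν ω) (permVal (σ ω) 2)}) ↔
       ω ∈ ⋃ e ∈ (Finset.univ : Finset (Equiv.Perm (Fin N'))),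
          ({ω | σ ω = e} ∩ ν ⁻¹' (evSet N e)) := by
    filter_upwards [hsum] with ω hω
    have := mem_evSet hN' hω (σ ω)
    simp only [Set.mem_iUnion, mem_univ, exists_prop, true_and]
    constructor
    · intro h
      exact ⟨σ ω, rfl, this.2 h⟩
    · rintro ⟨e, h1, h2⟩
      have h1 : σ ω = e := h1
      subst h1
      exact this.1 h2
  have hmE : ∀ e : Equiv.Perm (Fin N'), MeasurableSet (ν ⁻¹' (evSet N e)) := fun e =>
    hνmeas (measurableSet_evSet N e)
  rw [measure_congr (Filter.eventuallyEq_set.2 hset), measure_biUnion_finset]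
  rotate_left
  · intro a _ b _ hab
    refine Set.disjoint_left.2 ?_
    rintro ω ⟨h1, _⟩ ⟨h2, _⟩
    exact hab (Eq.trans (Eq.symm h1) h2)
  · intro e _
    exact (hσmeas e).inter (hmE e)
  rw [ENNReal.toReal_sum (fun _ _ => measure_ne_top _ _)]
  have hterm : ∀ e : Equiv.Perm (Fin N'), (P ({ω | σ ω = e} ∩ ν ⁻¹' (evSet N e))).toReal
      = ∫ ω, (N'.factorial : ℝ)⁻¹ * (ν ⁻¹' (evSet N e)).indicator 1 ω ∂P := by
    intro e
    rw [hindep e _ (measurableSet_evSet N e), hσunif, ENNReal.toReal_mul, integral_const_mul,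
      integral_indicator_one (hmE e)]
    simp [Measure.real]
  simp only [hterm]
  rw [← integral_finsetSum]
  swap
  · intro e _
    exact ((integrable_const (1:ℝ)).indicator (hmE e)).const_mul _
  have hD : (N'.descFactorial 4 : ℝ) ≠ 0 := by
    have : N'.descFactorial 4 ≠ 0 := by
      rw [Ne, Nat.descFactorial_eq_zero_iff_lt]; omega
    exact_mod_cast this
  have hF : (N'.factorial : ℝ) ≠ 0 := by exact_mod_cast Nat.factorial_ne_zero N'
  have hae : (fun ω => ∑ e : Equiv.Perm (Fin N'),
      (N'.factorial : ℝ)⁻¹ * (ν ⁻¹' (evSet N e)).indicator (1 : Ω → ℝ) ω) =ᵐ[P]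
      fun ω => (N'.descFactorial 4 : ℝ)⁻¹ * ∑ p ∈ (Finset.range N).offDiag,
          ((ν ω p.1).descFactorial 2 : ℝ) * ((ν ω p.2).descFactorial 2 : ℝ) := by
    filter_upwards [hsum] with ω hω
    have hc := evSet_count hN' hω
    have hc' : (#{e : Equiv.Perm (Fin N') | ν ω ∈ evSet N e} : ℝ) * (N'.descFactorial 4 : ℝ)
      = (∑ p ∈ (Finset.range N).offDiag,
          ((ν ω p.1).descFactorial 2 : ℝ) * ((ν ω p.2).descFactorial 2 : ℝ)) * N'.factorial := by
      exact_mod_cast hc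
    have hi : ∑ e : Equiv.Perm (Fin N'), (ν ⁻¹' (evSet N e)).indicator (1 : Ω → ℝ) ω
        = (#{e : Equiv.Perm (Fin N') | ν ω ∈ evSet N e} : ℝ) := by
      rw [Finset.card_filter]
      push_cast
      refine Finset.sum_congr rfl fun e _ => ?_
      simp [Set.indicator_apply]
    rw [← Finset.mul_sum, hi]
    field_simp
    linarith
  rw [integral_congr_ae hae, integral_const_mul, integral_finsetSum]
  swap
  · rintro ⟨i, j⟩ hp
    simp only [mem_offDiag, mem_range] at hp
    have hd : ∀ k, Measurable (fun ω => ((ν ω k).descFactorial 2 : ℝ)) := fun k =>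
      (Measurable.of_discrete (f := fun n : ℕ => ((n.descFactorial 2 : ℕ) : ℝ))).comp
        ((measurable_pi_apply k).comp hνmeas)
    refine Integrable.of_bound ((hd i).mul (hd j)).aestronglyMeasurable
      ((N'.descFactorial 2 : ℝ) * (N'.descFactorial 2 : ℝ)) ?_
    filter_upwards [hsum] with ω hω
    have hk : ∀ k < N, (ν ω k).descFactorial 2 ≤ N'.descFactorial 2 := by
      intro k hk
      refine Nat.descFactorial_le 2 ?_
      rw [← hω]
      exact Finset.single_le_sum (f := fun k => ν ω k) (fun _ _ => Nat.zero_le _)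
        (Finset.mem_range.2 hk)
    rw [Real.norm_of_nonneg (by positivity)]
    have := Nat.mul_le_mul (hk i hp.1) (hk j hp.2.1)
    exact_mod_cast this
  rw [Finset.sum_congr rfl (g := fun _ => ∫ ω, ((ν ω 0).descFactorial 2 : ℝ) *
    ((ν ω 1).descFactorial 2 : ℝ) ∂P)]
  · rw [Finset.sum_const, Finset.offDiag_card, Finset.card_range, nsmul_eq_mul]
    have : N * N - N = N.descFactorial 2 := by
      simp [Nat.descFactorial]; rw [Nat.mul_comm (N-1), Nat.mul_sub_one]
    rw [this]
    ring
  · rintro ⟨i, j⟩ hp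
    simp only [mem_offDiag, mem_range] at hp
    exact exch_integral P N hN ν hνmeas hexch i j hp.1 hp.2.1 hp.2.2
end

section
/- For all integers K ≥ 1 and 1 ≤ l ≤ N', P(𝔭(u_1) = 𝔭(u_2) = ⋯ = 𝔭(u_l) and ν_{𝔭(u_1)} ≤ K) = (N / (N')_l) · E[(ν_1)_l · 1{ν_1 ≤ K}]. (Here ν_{𝔭(u_1)} is the number of children of the common parent, i.e. the size of the block containing u_1.) -/
open MeasureTheory Finset
open scoped ENNReal

lemma aux_card_perm {M : ℕ} (l : ℕ) (hl : l ≤ M) (B : Finset (Fin M)) :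
    #{e : Equiv.Perm (Fin M) | ∀ j : Fin M, (j : ℕ) < l → e j ∈ B}
      = (#B).descFactorial l * (M - l).factorial := by
  classical
  let s : Set (Fin M) := {j | (j : ℕ) < l}
  have hs : Fintype.card s = l := by
    rw [Fintype.card_subtype]
    have := Fin.card_filter_val_lt (n := M) (m := l)
    simpa [s, hl] using this
  let F : (s ↪ B) → (s ↪ Fin M) := fun f => f.trans (Function.Embedding.subtype _)
  have h1 : Finset.filter (fun e : Equiv.Perm (Fin M) => ∀ j : Fin M, (j : ℕ) < l → e j ∈ B) univ
      = (univ : Finset (s ↪ B)).biUnion (fun f => Finset.filter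
        (fun e : Equiv.Perm (Fin M) => ∀ x : s, e x = F f x) univ) := by
    ext e
    simp only [mem_filter, mem_univ, true_and, mem_biUnion]
    constructor
    · intro h
      refine ⟨⟨fun x => ⟨e x, h x x.2⟩, fun x y hxy => ?_⟩, fun x => rfl⟩
      simpa [Subtype.ext_iff] using hxy
    · rintro ⟨f, hf⟩ j hj
      rw [show e j = _ from hf ⟨j, hj⟩]
      exact (f ⟨j, hj⟩).2
  rw [h1, card_biUnion]
  · have h2 : ∀ f ∈ (univ : Finset (s ↪ B)), #(Finset.filter
        (fun e : Equiv.Perm (Fin M) => ∀ x : s, e x = F f x) univ) = (M - l).factorial := by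
      intro f _
      let e₀ := Equiv.ofInjective (F f) (F f).injective
      have h3 := Fintype.card_congr (Equiv.Set.compl e₀)
      rw [← Fintype.card_subtype]
      have hc : Fintype.card (sᶜ : Set (Fin M)) = M - l := by
        rw [Fintype.card_compl_set, hs, Fintype.card_fin]
      have hc2 : Fintype.card ((Set.range (F f))ᶜ : Set (Fin M)) = M - l := by
        rw [Fintype.card_compl_set, ← Fintype.card_congr e₀, hs, Fintype.card_fin]
      rw [Fintype.card_equiv (Fintype.equivOfCardEq (hc.trans hc2.symm)), hc] at h3
      rw [← h3]
      exact Fintype.card_congr (Equiv.refl _)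
    rw [sum_congr rfl h2, sum_const, card_univ, Fintype.card_embedding_eq, hs, Fintype.card_coe,
      smul_eq_mul]
  · intro f _ g _ hfg
    rw [Function.onFun, Finset.disjoint_left]
    intro e he he'
    simp only [mem_filter, mem_univ, true_and] at he he'
    apply hfg
    ext x
    have := (he x).symm.trans (he' x)
    simpa [F] using congrArg Fin.val this

lemma aux_parent (v : ℕ → ℕ) (N c i : ℕ) (hc : c < ∑ j ∈ range N, v j) :
    parentMap v c = i ↔ ∑ j ∈ range i, v j ≤ c ∧ c < ∑ j ∈ range (i + 1), v j := by
  have mono : Monotone fun n => ∑ j ∈ range n, v j := fun a b h =>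
    sum_le_sum_of_subset (range_mono h)
  have hne : {i : ℕ | c < ∑ j ∈ Finset.range (i + 1), v j}.Nonempty :=
    ⟨N, lt_of_lt_of_le hc (mono (Nat.le_succ N))⟩
  constructor
  · rintro rfl
    refine ⟨?_, Nat.sInf_mem hne⟩
    by_contra! h
    rcases hp : parentMap v c with _ | k
    · simp [hp] at h
    · rw [hp] at h
      have : parentMap v c ≤ k := Nat.sInf_le h
      omega
  · rintro ⟨h1, h2⟩
    have h5 : parentMap v c ≤ i := Nat.sInf_le (m := i) (s := {i : ℕ | c < ∑ j ∈ Finset.range (i + 1), v j}) h2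
    apply le_antisymm h5
    by_contra! h
    have h3 : c < ∑ j ∈ range (parentMap v c + 1), v j := Nat.sInf_mem hne
    have h4 : parentMap v c + 1 ≤ i := h
    have := mono h4
    simp only at this
    exact absurd (h3.trans_le (this.trans h1)) (lt_irrefl _)

lemma aux_parent_lt (v : ℕ → ℕ) (N c : ℕ) (hc : c < ∑ j ∈ range N, v j) :
    parentMap v c < N := by
  have h := ((aux_parent v N c _ hc).1 rfl).1
  by_contra! h'
  have : ∑ j ∈ range N, v j ≤ ∑ j ∈ range (parentMap v c), v j :=
    sum_le_sum_of_subset (range_mono h')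
  omega

/-- block -/
def blk (M : ℕ) (v : ℕ → ℕ) (i : ℕ) : Finset (Fin M) :=
  {c | ∑ j ∈ range i, v j ≤ (c : ℕ) ∧ (c : ℕ) < ∑ j ∈ range (i + 1), v j}

lemma aux_card_blk (M N : ℕ) (v : ℕ → ℕ) (h : ∑ j ∈ range N, v j = M) (i : ℕ) (hi : i < N) :
    #(blk M v i) = v i := by
  have hle : ∑ j ∈ range (i + 1), v j ≤ M := h ▸ sum_le_sum_of_subset (range_mono hi)
  have h1 : (blk M v i).map Fin.valEmbedding
      = Finset.Ico (∑ j ∈ range i, v j) (∑ j ∈ range (i + 1), v j) := by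
    ext c
    simp only [blk, mem_map, mem_filter, mem_univ, true_and, Fin.valEmbedding_apply, mem_Ico]
    constructor
    · rintro ⟨a, ha, rfl⟩; exact ha
    · intro hc; exact ⟨⟨c, by omega⟩, hc, rfl⟩
  rw [← card_map Fin.valEmbedding, h1, Nat.card_Ico, sum_range_succ]
  omega

/-- the good set -/
def goodSet (N M K l : ℕ) (e : Equiv.Perm (Fin M)) : Set (ℕ → ℕ) :=
  {v | ∃ i < N, v i ≤ K ∧ ∀ j : Fin M, (j : ℕ) < l → e j ∈ blk M v i}

lemma aux_good_meas (N M K l : ℕ) (e : Equiv.Perm (Fin M)) :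
    MeasurableSet (goodSet N M K l e) := by
  have : goodSet N M K l e = ⋃ i ∈ Set.Iio N, ({v : ℕ → ℕ | v i ≤ K} ∩
      ⋂ j : Fin M, ⋂ _ : (j : ℕ) < l, ({v : ℕ → ℕ | ∑ j ∈ range i, v j ≤ (e j : ℕ)} ∩
        {v : ℕ → ℕ | (e j : ℕ) < ∑ j ∈ range (i + 1), v j})) := by
    ext v
    simp only [goodSet, blk, Set.mem_setOf_eq, mem_filter, mem_univ, true_and, Set.mem_iUnion,
      Set.mem_inter_iff, Set.mem_iInter, Set.mem_Iio, exists_prop]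
  rw [this]
  refine MeasurableSet.biUnion (Set.to_countable _) fun i _ => MeasurableSet.inter ?_ ?_
  · exact measurableSet_le (measurable_pi_apply i) measurable_const
  · refine MeasurableSet.iInter fun j => MeasurableSet.iInter fun _ => MeasurableSet.inter ?_ ?_
    · exact measurableSet_le (by fun_prop) measurable_const
    · exact measurableSet_lt measurable_const (by fun_prop)

lemma aux_event (N M K l : ℕ) (hl : 1 ≤ l) (hlM : l ≤ M) (e : Equiv.Perm (Fin M)) (v : ℕ → ℕ)
    (h : ∑ j ∈ range N, v j = M) :
    ((∀ i < l, parentMap v (permVal e i) = parentMap v (permVal e 0))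
      ∧ v (parentMap v (permVal e 0)) ≤ K) ↔ v ∈ goodSet N M K l e := by
  have hp : ∀ j (hj : j < M), permVal e j = e ⟨j, hj⟩ := fun j hj => by simp [permVal, hj]
  have key : ∀ j (hj : j < M) i, e ⟨j, hj⟩ ∈ blk M v i ↔ parentMap v (permVal e j) = i := by
    intro j hj i
    rw [hp j hj, aux_parent v N _ i (by rw [h]; exact (e ⟨j, hj⟩).2)]
    simp [blk]
  constructor
  · rintro ⟨h1, h2⟩
    refine ⟨_, aux_parent_lt v N (permVal e 0) ?_, h2, fun j hj => ?_⟩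
    · rw [hp 0 (by omega), h]; exact Fin.is_lt _
    · exact (key j j.2 _).2 (h1 j hj)
  · rintro ⟨i, hi, h1, h2⟩
    have h3 : ∀ j < l, parentMap v (permVal e j) = i := fun j hj =>
      (key j (by omega) i).1 (h2 ⟨j, by omega⟩ hj)
    rw [h3 0 (by omega)]
    exact ⟨h3, h1⟩

open Classical in
lemma aux_count (N M K l : ℕ) (hl : 1 ≤ l) (hlM : l ≤ M) (v : ℕ → ℕ)
    (h : ∑ j ∈ range N, v j = M) :
    #{e : Equiv.Perm (Fin M) | v ∈ goodSet N M K l e}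
      = ∑ i ∈ range N, ((v i).descFactorial l * if v i ≤ K then 1 else 0) * (M - l).factorial := by
  have h1 : Finset.filter (fun e : Equiv.Perm (Fin M) => v ∈ goodSet N M K l e) univ
     = (range N).biUnion fun i => Finset.filter (fun e : Equiv.Perm (Fin M) =>
        v i ≤ K ∧ ∀ j : Fin M, (j : ℕ) < l → e j ∈ blk M v i) univ := by
    ext e
    simp only [goodSet, mem_filter, mem_univ, true_and, mem_biUnion, mem_range, Set.mem_setOf_eq]
  rw [h1, card_biUnion]
  · refine sum_congr rfl fun i hi => ?_
    by_cases hK : v i ≤ K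
    · simp only [hK, true_and, if_true, mul_one]
      have := aux_card_perm l hlM (blk M v i)
      rw [aux_card_blk M N v h i (mem_range.1 hi)] at this
      rw [← this]
    · simp [hK]
  · intro i _ k _ hik
    rw [Function.onFun, Finset.disjoint_left]
    intro e he he'
    simp only [mem_filter, mem_univ, true_and] at he he'
    apply hik
    have h0 : (0:ℕ) < M := by omega
    have a := he.2 ⟨0, h0⟩ hl
    have b := he'.2 ⟨0, h0⟩ hl
    simp only [blk, mem_filter, mem_univ, true_and] at a b
    have hc : ((e ⟨0, h0⟩ : Fin M) : ℕ) < ∑ j ∈ range N, v j := by rw [h]; exact Fin.is_lt _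
    rw [← (aux_parent v N _ i hc).2 a, ← (aux_parent v N _ k hc).2 b]

/-- For `K ≥ 1` and `1 ≤ l ≤ N'`,
`P(𝔭(u_1) = ⋯ = 𝔭(u_l) and ν_{𝔭(u_1)} ≤ K) = (N / (N')_l) · E[(ν_1)_l · 1{ν_1 ≤ K}]`.
(Indices of `u` and `ν` are shifted to be `0`-based.) -/
theorem coalescent_truncated_merge_probability
    {Ω : Type*} [MeasurableSpace Ω] (P : Measure Ω) [IsProbabilityMeasure P]
    (N N' : ℕ) (hN : 0 < N) (hN' : 0 < N')
    (ν : Ω → ℕ → ℕ) (hνmeas : Measurable ν)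
    (hsum : ∀ᵐ ω ∂P, ∑ i ∈ Finset.range N, ν ω i = N')
    (hexch : ∀ π : Equiv.Perm (Fin N),
      Measure.map (fun ω => fun i : Fin N => ν ω (π i)) P
        = Measure.map (fun ω => fun i : Fin N => ν ω i) P)
    (σ : Ω → Equiv.Perm (Fin N'))
    (hσmeas : ∀ e, MeasurableSet {ω | σ ω = e})
    (hσunif : ∀ e : Equiv.Perm (Fin N'),
      P {ω | σ ω = e} = 1 / (Nat.factorial N' : ℝ≥0∞))
    (hindep : ∀ (e : Equiv.Perm (Fin N')) (S : Set (ℕ → ℕ)), MeasurableSet S →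
      P ({ω | σ ω = e} ∩ ν ⁻¹' S) = P {ω | σ ω = e} * P (ν ⁻¹' S))
    (K l : ℕ) (hK : 1 ≤ K) (hl : 1 ≤ l) (hlN' : l ≤ N') :
    (P {ω | (∀ i < l, parentMap (ν ω) (permVal (σ ω) i)
              = parentMap (ν ω) (permVal (σ ω) 0))
          ∧ ν ω (parentMap (ν ω) (permVal (σ ω) 0)) ≤ K}).toReal
      = ((N : ℝ) / (N'.descFactorial l : ℝ))
        * ∫ ω, ((ν ω 0).descFactorial l : ℝ) * (if ν ω 0 ≤ K then (1 : ℝ) else 0) ∂P := by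
  classical
  have hev : {ω | (∀ i < l, parentMap (ν ω) (permVal (σ ω) i)
              = parentMap (ν ω) (permVal (σ ω) 0))
          ∧ ν ω (parentMap (ν ω) (permVal (σ ω) 0)) ≤ K}
      =ᵐ[P] ⋃ e ∈ (univ : Finset (Equiv.Perm (Fin N'))),
        ({ω | σ ω = e} ∩ ν ⁻¹' goodSet N N' K l e) := by
    filter_upwards [hsum] with ω hω
    apply propext
    refine (aux_event N N' K l hl hlN' (σ ω) (ν ω) hω).trans ?_
    change _ ↔ ω ∈ ⋃ e ∈ (univ : Finset (Equiv.Perm (Fin N'))),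
        ({ω | σ ω = e} ∩ ν ⁻¹' goodSet N N' K l e)
    simp
  have hgm : ∀ e, MeasurableSet (ν ⁻¹' goodSet N N' K l e) := fun e =>
    hνmeas (aux_good_meas N N' K l e)
  have hP : (P {ω | (∀ i < l, parentMap (ν ω) (permVal (σ ω) i)
              = parentMap (ν ω) (permVal (σ ω) 0))
          ∧ ν ω (parentMap (ν ω) (permVal (σ ω) 0)) ≤ K}).toReal
      = ∑ e : Equiv.Perm (Fin N'), (1 / (N'.factorial : ℝ)) *
          ∫ ω, (ν ⁻¹' goodSet N N' K l e).indicator (fun _ => (1:ℝ)) ω ∂P := by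
    rw [measure_congr hev, measure_biUnion_finset, ENNReal.toReal_sum]
    · refine sum_congr rfl fun e _ => ?_
      rw [hindep e _ (aux_good_meas N N' K l e), hσunif, ENNReal.toReal_mul,
        integral_indicator_const _ (hgm e)]
      simp [Measure.real]
    · intro e _; exact measure_ne_top _ _
    · intro a _ b _ hab
      rw [Function.onFun, Set.disjoint_left]
      rintro ω ⟨h1, _⟩ ⟨h2, _⟩
      exact hab (h1.symm.trans h2)
    · intro e _; exact (hσmeas e).inter (hgm e)
  let f : ℕ → ℝ := fun n => (n.descFactorial l : ℝ) * (if n ≤ K then (1 : ℝ) else 0)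
  have hmi : ∀ i, Measurable fun ω => ν ω i := fun i => (measurable_pi_apply i).comp hνmeas
  have hfi : ∀ i, Integrable (fun ω => f (ν ω i)) P := by
    intro i
    refine Integrable.of_bound (C := (K : ℝ) ^ l)
      ((measurable_of_countable f).comp (hmi i)).aestronglyMeasurable (Filter.Eventually.of_forall ?_)
    intro ω
    by_cases h : ν ω i ≤ K
    · simp only [f, h, if_true, mul_one, Real.norm_natCast]
      exact_mod_cast (Nat.descFactorial_le_pow _ _).trans (Nat.pow_le_pow_left h l)
    · simp [f, h]
  have hex : ∀ i ∈ range N, ∫ ω, f (ν ω i) ∂P = ∫ ω, f (ν ω 0) ∂P := by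
    intro i hi
    have hi := mem_range.1 hi
    let π : Equiv.Perm (Fin N) := Equiv.swap ⟨0, hN⟩ ⟨i, hi⟩
    have h1 := congrArg (fun m => ∫ w : Fin N → ℕ, f (w ⟨0, hN⟩) ∂m) (hexch π)
    have hm : Measurable fun w : Fin N → ℕ => f (w ⟨0, hN⟩) :=
      (measurable_of_countable f).comp (measurable_pi_apply _)
    rw [integral_map (measurable_pi_lambda _ fun a => hmi _).aemeasurable hm.aestronglyMeasurable,
      integral_map (measurable_pi_lambda _ fun a => hmi _).aemeasurable hm.aestronglyMeasurable]
      at h1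
    simpa [π] using h1
  have hint : ∑ e : Equiv.Perm (Fin N'),
          ∫ ω, (ν ⁻¹' goodSet N N' K l e).indicator (fun _ => (1:ℝ)) ω ∂P
      = (N : ℝ) * (∫ ω, f (ν ω 0) ∂P) * ((N' - l).factorial : ℝ) := by
    rw [← integral_finsetSum]
    · have : (fun ω => ∑ e : Equiv.Perm (Fin N'),
          (ν ⁻¹' goodSet N N' K l e).indicator (fun _ => (1:ℝ)) ω)
          =ᵐ[P] fun ω => ∑ i ∈ range N, f (ν ω i) * ((N' - l).factorial : ℝ) := by
        filter_upwards [hsum] with ω hω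
        have h1 := congrArg (Nat.cast : ℕ → ℝ) (aux_count N N' K l hl hlN' (ν ω) hω)
        push_cast at h1
        simp only [f]
        rw [← h1]
        simp [Set.indicator_apply]
      rw [integral_congr_ae this, integral_finsetSum _ fun i _ => (hfi i).mul_const _]
      simp_rw [integral_mul_const]
      rw [← sum_mul, sum_congr rfl hex, sum_const, card_range, nsmul_eq_mul]
    · intro e _
      exact (integrable_const _).indicator (hgm e)
  rw [hP, ← mul_sum, hint]
  have hd : ((N' - l).factorial : ℝ) * (N'.descFactorial l : ℝ) = (N'.factorial : ℝ) := by
    exact_mod_cast Nat.factorial_mul_descFactorial hlN'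
  have h1 : ((N' - l).factorial : ℝ) ≠ 0 := by exact_mod_cast Nat.factorial_ne_zero _
  have h2 : (N'.factorial : ℝ) ≠ 0 := by exact_mod_cast Nat.factorial_ne_zero _
  have h3 : (N'.descFactorial l : ℝ) ≠ 0 := by
    intro h; rw [h, mul_zero] at hd; exact h2 hd.symm
  change _ = (N : ℝ) / _ * ∫ ω, f (ν ω 0) ∂P
  rw [← hd]
  field_simp
end

section
/- E[ν_1² ν_2²] ≤ (N' / (N − 1)) · E[ν_1³]. -/
open MeasureTheory Finset

/-- For an exchangeable vector `(ν_1,…,ν_N)` of nonnegative integers with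
`ν_1 + ⋯ + ν_N = N'` a.s. (`N ≥ 2`, `N' ≥ 1`):  `E[ν_1² ν_2²] ≤ (N' / (N − 1)) · E[ν_1³]`.
(Indices of `ν` are shifted to be `0`-based.) -/
theorem exchangeable_sq_sq_moment_le
    {Ω : Type*} [MeasurableSpace Ω] (P : Measure Ω) [IsProbabilityMeasure P]
    (N N' : ℕ) (hN : 2 ≤ N) (hN' : 1 ≤ N')
    (ν : Ω → ℕ → ℕ) (hνmeas : Measurable ν)
    (hsum : ∀ᵐ ω ∂P, ∑ i ∈ Finset.range N, ν ω i = N')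
    (hexch : ∀ π : Equiv.Perm (Fin N),
      Measure.map (fun ω => fun i : Fin N => ν ω (π i)) P
        = Measure.map (fun ω => fun i : Fin N => ν ω i) P) :
    (∫ ω, ((ν ω 0 : ℝ)) ^ 2 * ((ν ω 1 : ℝ)) ^ 2 ∂P)
      ≤ ((N' : ℝ) / ((N : ℝ) - 1)) * ∫ ω, ((ν ω 0 : ℝ)) ^ 3 ∂P := by
  have hN0 : 0 < N := by omega
  have hN1 : 1 < N := by omega
  set X : Ω → Fin N → ℕ := fun ω i => ν ω i with hX
  have hXm : Measurable X :=
    measurable_pi_lambda _ fun i => (measurable_pi_apply (i : ℕ)).comp hνmeas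
  have hs : ∀ᵐ ω ∂P, ∑ i, X ω i = N' := by
    filter_upwards [hsum] with ω h
    rw [← h, Finset.sum_range]
  have hle : ∀ᵐ ω ∂P, ∀ i, X ω i ≤ N' := by
    filter_upwards [hs] with ω h i
    rw [← h]
    exact Finset.single_le_sum (f := X ω) (fun _ _ => Nat.zero_le _) (Finset.mem_univ i)
  have hfm : ∀ f : (Fin N → ℕ) → ℝ, Measurable f := fun f => measurable_of_countable f
  have hint : ∀ f : (Fin N → ℕ) → ℝ, Integrable (fun ω => f (X ω)) P := by
    intro f
    refine Integrable.of_bound ((hfm f).comp hXm).aestronglyMeasurable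
      (∑ v ∈ Finset.Iic (fun _ : Fin N => N'), |f v|) ?_
    filter_upwards [hle] with ω h
    rw [Real.norm_eq_abs]
    exact Finset.single_le_sum (f := fun v => |f v|) (fun _ _ => abs_nonneg _)
      (Finset.mem_Iic.2 h)
  have hex : ∀ (π : Equiv.Perm (Fin N)) (f : (Fin N → ℕ) → ℝ),
      ∫ ω, f (fun i => X ω (π i)) ∂P = ∫ ω, f (X ω) ∂P := by
    intro π f
    have hXp : Measurable (fun ω => fun i => X ω (π i)) :=
      measurable_pi_lambda _ fun i => (measurable_pi_apply (π i)).comp hXm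
    have h1 := integral_map (μ := P) hXp.aemeasurable
      (f := f) (hfm f).aestronglyMeasurable
    have h2 := integral_map (μ := P) hXm.aemeasurable
      (f := f) (hfm f).aestronglyMeasurable
    rw [← h1, ← h2]
    exact congrArg (fun m => ∫ v, f v ∂m) (hexch π)
  let a : Fin N := ⟨0, hN0⟩
  let b : Fin N := ⟨1, hN1⟩
  have hab : b ≠ a := by simp [a, b]
  have key : ∫ ω, (X ω a : ℝ) ^ 2 * (X ω b : ℝ) ^ 2 ∂P ≤ ∫ ω, (X ω a : ℝ) ^ 3 * (X ω b : ℝ) ∂P := by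
    have h1 : ∫ ω, (X ω b : ℝ) ^ 3 * (X ω a : ℝ) ∂P = ∫ ω, (X ω a : ℝ) ^ 3 * (X ω b : ℝ) ∂P := by
      have := hex (Equiv.swap a b) (fun v => (v a : ℝ) ^ 3 * (v b : ℝ))
      simpa using this
    have h2 : ∫ ω, 2 * ((X ω a : ℝ) ^ 2 * (X ω b : ℝ) ^ 2) ∂P ≤
        ∫ ω, ((X ω a : ℝ) ^ 3 * (X ω b : ℝ) + (X ω b : ℝ) ^ 3 * (X ω a : ℝ)) ∂P := by
      refine integral_mono (hint fun v => 2 * ((v a : ℝ) ^ 2 * (v b : ℝ) ^ 2))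
        (hint fun v => (v a : ℝ) ^ 3 * (v b : ℝ) + (v b : ℝ) ^ 3 * (v a : ℝ)) fun ω => ?_
      have : 0 ≤ (X ω a : ℝ) * (X ω b : ℝ) * ((X ω a : ℝ) - X ω b) ^ 2 := by positivity
      dsimp only
      nlinarith
    rw [integral_const_mul, integral_add (hint fun v => (v a : ℝ) ^ 3 * (v b : ℝ))
      (hint fun v => (v b : ℝ) ^ 3 * (v a : ℝ)), h1] at h2
    linarith
  have hj : ∀ j ∈ Finset.univ.erase a, ∫ ω, (X ω a : ℝ) ^ 3 * (X ω j : ℝ) ∂P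
      = ∫ ω, (X ω a : ℝ) ^ 3 * (X ω b : ℝ) ∂P := by
    intro j hj
    have hja : j ≠ a := Finset.ne_of_mem_erase hj
    have := hex (Equiv.swap b j) (fun v => (v a : ℝ) ^ 3 * (v b : ℝ))
    simpa [Equiv.swap_apply_of_ne_of_ne hab.symm hja.symm] using this
  have hsum2 : ((N : ℝ) - 1) * ∫ ω, (X ω a : ℝ) ^ 3 * (X ω b : ℝ) ∂P
      ≤ N' * ∫ ω, (X ω a : ℝ) ^ 3 ∂P := by
    have h1 := Finset.sum_congr rfl hj
    rw [Finset.sum_const, Finset.card_erase_of_mem (Finset.mem_univ a), Finset.card_univ,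
      Fintype.card_fin, nsmul_eq_mul, Nat.cast_sub (by omega), Nat.cast_one,
      ← integral_finsetSum _ (fun j _ => hint fun v => (v a : ℝ) ^ 3 * (v j : ℝ))] at h1
    rw [← h1, ← integral_const_mul]
    refine integral_mono_ae
      (hint fun v => ∑ j ∈ Finset.univ.erase a, (v a : ℝ) ^ 3 * (v j : ℝ))
      (hint fun v => N' * (v a : ℝ) ^ 3) ?_
    filter_upwards [hs] with ω h
    rw [← Finset.mul_sum, mul_comm]
    refine mul_le_mul_of_nonneg_right ?_ (by positivity)
    rw [← h]
    push_cast
    exact Finset.sum_le_sum_of_subset_of_nonneg (Finset.erase_subset _ _)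
      (fun _ _ _ => Nat.cast_nonneg _)
  have hpos : (0 : ℝ) < (N : ℝ) - 1 := by
    have : (1 : ℝ) < N := by exact_mod_cast hN1
    linarith
  refine key.trans ?_
  rw [div_mul_eq_mul_div, le_div_iff₀ hpos, mul_comm]
  exact hsum2
end

section
/- For every integer 2 ≤ m ≤ N, (N − m + 1) · E[ν_1 ν_2 ⋯ ν_m] = N' · E[ν_1 ν_2 ⋯ ν_{m−1}] − (m − 1) · E[ν_1² ν_2 ⋯ ν_{m−1}], where the products ν_1⋯ν_{m−1} and ν_2⋯ν_{m−1} are interpreted as 1 and ν_1²·1 respectively when m = 2. -/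
open MeasureTheory Finset

theorem swap_integral_aux
    {Ω : Type*} [MeasurableSpace Ω] (P : Measure Ω) 
    (N : ℕ) (ν : Ω → ℕ → ℕ) (hνmeas : Measurable ν)
    (hexch : ∀ π : Equiv.Perm (Fin N),
      Measure.map (fun ω => fun i : Fin N => ν ω (π i)) P
        = Measure.map (fun ω => fun i : Fin N => ν ω i) P)
    (k a b : ℕ) (hk : k ≤ N) (ha : a < N) (hb : b < N)
    (hab : (a < k ∧ b < k) ∨ (k ≤ a ∧ k ≤ b)) :
    ∫ ω, (ν ω a : ℝ) * ∏ i ∈ Finset.range k, (ν ω i : ℝ) ∂P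
      = ∫ ω, (ν ω b : ℝ) * ∏ i ∈ Finset.range k, (ν ω i : ℝ) ∂P := by
  have hm : ∀ i, Measurable (fun ω => ν ω i) := fun i => (measurable_pi_apply i).comp hνmeas
  let a' : Fin N := ⟨a, ha⟩
  let b' : Fin N := ⟨b, hb⟩
  let S : Finset (Fin N) := Finset.univ.filter (fun i => i.val < k)
  have hS : ∀ f : ℕ → ℝ, ∏ i ∈ Finset.range k, f i = ∏ i ∈ S, f i.val := by
    intro f
    symm
    refine Finset.prod_bij (fun i _ => i.val) ?_ ?_ ?_ ?_
    · intro i hi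
      simpa [S] using hi
    · intro i _ j _ h
      exact Fin.ext h
    · intro i hi
      have := Finset.mem_range.1 hi
      exact ⟨⟨i, by omega⟩, by simpa [S] using this, rfl⟩
    · intros
      rfl
  let g : (Fin N → ℕ) → ℝ := fun x => (x a' : ℝ) * ∏ i ∈ S, (x i : ℝ)
  have hg : Measurable g := Measurable.of_discrete
  have h1 : ∫ ω, g (fun i : Fin N => ν ω i) ∂P
      = ∫ ω, g (fun i : Fin N => ν ω (Equiv.swap a' b' i)) ∂P := by
    rw [← integral_map (φ := fun ω => fun i : Fin N => ν ω i)
        (measurable_pi_lambda _ fun i => hm _).aemeasurable hg.aestronglyMeasurable,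
      ← integral_map (φ := fun ω => fun i : Fin N => ν ω (Equiv.swap a' b' i))
        (measurable_pi_lambda _ fun i => hm _).aemeasurable hg.aestronglyMeasurable, hexch]
  have h2 : ∀ ω, g (fun i : Fin N => ν ω i)
      = (ν ω a : ℝ) * ∏ i ∈ Finset.range k, (ν ω i : ℝ) := by
    intro ω
    rw [hS]
  have h3 : ∀ ω, g (fun i : Fin N => ν ω (Equiv.swap a' b' i))
      = (ν ω b : ℝ) * ∏ i ∈ Finset.range k, (ν ω i : ℝ) := by
    intro ω
    rw [hS]
    simp only [g, Equiv.swap_apply_left]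
    congr 1
    refine Finset.prod_equiv (Equiv.swap a' b') ?_ (fun _ _ => rfl)
    intro i
    simp only [S, Finset.mem_filter, Finset.mem_univ, true_and]
    rw [Equiv.swap_apply_def]
    split_ifs with e1 e2
    · subst e1
      simp only [a', b']
      omega
    · subst e2
      simp only [a', b']
      omega
    · rfl
  simp only [h2, h3] at h1
  exact h1

/-- For an exchangeable vector `(ν_1,…,ν_N)` of nonnegative integers with
`ν_1 + ⋯ + ν_N = N'` a.s. (`N ≥ 2`, `N' ≥ 1`), and every `2 ≤ m ≤ N`:
`(N − m + 1) · E[ν_1 ⋯ ν_m] = N' · E[ν_1 ⋯ ν_{m−1}] − (m − 1) · E[ν_1² ν_2 ⋯ ν_{m−1}]`.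
(Indices of `ν` are shifted to be `0`-based: `ν_1 ⋯ ν_m` is the product over `range m`,
`ν_1 ⋯ ν_{m−1}` the product over `range (m-1)`, and `ν_1² ν_2 ⋯ ν_{m−1}` is
`(ν 0)² ·` the product over `Ico 1 (m-1)`; when `m = 2` the latter two are `1` and `(ν 0)²`.) -/
theorem exchangeable_product_moment_recursion
    {Ω : Type*} [MeasurableSpace Ω] (P : Measure Ω) [IsProbabilityMeasure P]
    (N N' : ℕ) (hN : 2 ≤ N) (hN' : 1 ≤ N')
    (ν : Ω → ℕ → ℕ) (hνmeas : Measurable ν)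
    (hsum : ∀ᵐ ω ∂P, ∑ i ∈ Finset.range N, ν ω i = N')
    (hexch : ∀ π : Equiv.Perm (Fin N),
      Measure.map (fun ω => fun i : Fin N => ν ω (π i)) P
        = Measure.map (fun ω => fun i : Fin N => ν ω i) P)
    (m : ℕ) (hm2 : 2 ≤ m) (hmN : m ≤ N) :
    ((N : ℝ) - (m : ℝ) + 1) * ∫ ω, ∏ i ∈ Finset.range m, (ν ω i : ℝ) ∂P
      = (N' : ℝ) * (∫ ω, ∏ i ∈ Finset.range (m - 1), (ν ω i : ℝ) ∂P)
        - ((m : ℝ) - 1) *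
            ∫ ω, ((ν ω 0 : ℝ)) ^ 2 * ∏ i ∈ Finset.Ico 1 (m - 1), (ν ω i : ℝ) ∂P := by
  have hm : ∀ i, Measurable (fun ω => ν ω i) := fun i => (measurable_pi_apply i).comp hνmeas
  obtain ⟨k, rfl⟩ : ∃ k, m = k + 2 := ⟨m - 2, by omega⟩
  have hk1 : k + 2 - 1 = k + 1 := by omega
  rw [hk1]
  let G : ℕ → Ω → ℝ := fun j ω => (ν ω j : ℝ) * ∏ i ∈ Finset.range (k + 1), (ν ω i : ℝ)
  have hle : ∀ᵐ ω ∂P, ∀ i < N, (ν ω i : ℝ) ≤ N' := by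
    filter_upwards [hsum] with ω h i hi
    rw [← h]
    exact_mod_cast Finset.single_le_sum (f := fun i => ν ω i) (fun _ _ => Nat.zero_le _)
      (Finset.mem_range.2 hi)
  have hint : ∀ j < N, Integrable (G j) P := by
    intro j hj
    refine Integrable.of_bound (C := (N' : ℝ) * ∏ i ∈ Finset.range (k + 1), (N' : ℝ)) ?_ ?_
    · refine Measurable.aestronglyMeasurable ?_
      have hr : ∀ i, Measurable (fun ω => (ν ω i : ℝ)) := fun i =>
        (Measurable.of_discrete (f := fun n : ℕ => (n : ℝ))).comp (hm i)
      exact (hr j).mul (Finset.measurable_fun_prod _ fun i _ => hr i)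
    · filter_upwards [hle] with ω h
      have h0 : 0 ≤ G j ω := by
        simp only [G]
        positivity
      rw [Real.norm_of_nonneg h0]
      refine mul_le_mul (h j hj) ?_ (by positivity) (by positivity)
      refine Finset.prod_le_prod (fun i _ => by positivity) fun i hi => h i ?_
      have := Finset.mem_range.1 hi
      omega
  have hA : (N' : ℝ) * (∫ ω, ∏ i ∈ Finset.range (k + 1), (ν ω i : ℝ) ∂P)
      = ∑ j ∈ Finset.range N, ∫ ω, G j ω ∂P := by
    rw [← integral_finset_sum _ fun j hj => hint j (Finset.mem_range.1 hj),
      ← integral_const_mul]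
    refine integral_congr_ae ?_
    filter_upwards [hsum] with ω h
    simp only [G]
    rw [← Finset.sum_mul, ← h]
    push_cast
    rfl
  have hlow : ∀ j ∈ Finset.range (k + 1), ∫ ω, G j ω ∂P = ∫ ω, G 0 ω ∂P := by
    intro j hj
    have := Finset.mem_range.1 hj
    exact swap_integral_aux P N ν hνmeas hexch (k + 1) j 0 (by omega) (by omega) (by omega)
      (by omega)
  have hhigh : ∀ j ∈ Finset.Ico (k + 1) N, ∫ ω, G j ω ∂P = ∫ ω, G (k + 1) ω ∂P := by
    intro j hj
    have := Finset.mem_Ico.1 hj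
    exact swap_integral_aux P N ν hνmeas hexch (k + 1) j (k + 1) (by omega) (by omega) (by omega)
      (by omega)
  have hB : ∀ ω, ∏ i ∈ Finset.range (k + 2), (ν ω i : ℝ) = G (k + 1) ω := by
    intro ω
    rw [Finset.prod_range_succ, mul_comm]
  have hC : ∀ ω, ((ν ω 0 : ℝ)) ^ 2 * ∏ i ∈ Finset.Ico 1 (k + 1), (ν ω i : ℝ) = G 0 ω := by
    intro ω
    simp only [G]
    rw [Finset.range_eq_Ico, Finset.prod_eq_prod_Ico_succ_bot (by omega : 0 < k + 1)]
    ring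
  rw [hA, ← Finset.sum_range_add_sum_Ico _ (by omega : k + 1 ≤ N),
    Finset.sum_congr rfl hlow, Finset.sum_congr rfl hhigh]
  simp only [hB, hC, Finset.sum_const, Finset.card_range, Nat.card_Ico, nsmul_eq_mul]
  rw [Nat.cast_sub (by omega)]
  push_cast
  ring
end

section
/- For every integer 1 ≤ m ≤ N, E[ν_1² ν_2 ⋯ ν_m] ≤ ((N')^{m−1} / (N−1)_{m−1}) · E[ν_1²], where (N−1)_{m−1} = (N−1)(N−2)⋯(N−m+1) is the falling factorial (equal to 1 when m = 1). -/
open MeasureTheory Finset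

lemma aux_integrable {Ω : Type*} [MeasurableSpace Ω] (P : Measure Ω) [IsProbabilityMeasure P]
    (N N' : ℕ) (hN : 2 ≤ N) (ν : Ω → ℕ → ℕ) (hνmeas : Measurable ν)
    (hsum : ∀ᵐ ω ∂P, ∑ i ∈ Finset.range N, ν ω i = N')
    (m j : ℕ) (hmN : m ≤ N) (hj : j < N) (k : ℕ) :
    Integrable (fun ω => ((ν ω 0 : ℝ)) ^ 2 * (∏ i ∈ Finset.Ico 1 m, (ν ω i : ℝ))
      * (ν ω j : ℝ) ^ k) P := by
  have hme : ∀ i, Measurable (fun ω => (ν ω i : ℝ)) := fun i =>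
    (measurable_of_countable (fun n : ℕ => (n : ℝ))).comp ((measurable_pi_apply i).comp hνmeas)
  refine Integrable.of_bound (C := (N' : ℝ) ^ 2 * (∏ i ∈ Finset.Ico 1 m, (N' : ℝ)) * (N' : ℝ) ^ k)
    ?_ ?_
  · exact ((((hme 0).pow_const 2).mul (Finset.measurable_fun_prod _ fun i _ => hme i)).mul
      ((hme j).pow_const k)).aestronglyMeasurable
  · filter_upwards [hsum] with ω hω
    have hb : ∀ i < N, (ν ω i : ℝ) ≤ N' := by
      intro i hi
      rw [← hω]
      exact_mod_cast Finset.single_le_sum (f := fun i => ν ω i) (fun _ _ => Nat.zero_le _)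
        (Finset.mem_range.2 hi)
    rw [Real.norm_of_nonneg (by positivity)]
    have h0 := hb 0 (by omega)
    have h1 := hb j hj
    have h2 : ∏ i ∈ Finset.Ico 1 m, (ν ω i : ℝ) ≤ ∏ i ∈ Finset.Ico 1 m, (N' : ℝ) :=
      Finset.prod_le_prod (fun _ _ => by positivity) fun i hi => hb i (by
        have := Finset.mem_Ico.1 hi; omega)
    gcongr

lemma aux_swap {Ω : Type*} [MeasurableSpace Ω] (P : Measure Ω)
    (N : ℕ) (ν : Ω → ℕ → ℕ) (hνmeas : Measurable ν)
    (hexch : ∀ π : Equiv.Perm (Fin N),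
      Measure.map (fun ω => fun i : Fin N => ν ω (π i)) P
        = Measure.map (fun ω => fun i : Fin N => ν ω i) P)
    (m j : ℕ) (hm1 : 1 ≤ m) (hmj : m ≤ j) (hj : j < N) :
    ∫ ω, ((ν ω 0 : ℝ)) ^ 2 * (∏ i ∈ Finset.Ico 1 m, (ν ω i : ℝ)) * (ν ω j : ℝ) ∂P
     = ∫ ω, ((ν ω 0 : ℝ)) ^ 2 * (∏ i ∈ Finset.Ico 1 m, (ν ω i : ℝ)) * (ν ω m : ℝ) ∂P := by
  have hmN : m < N := by omega
  let π : Equiv.Perm (Fin N) := Equiv.swap ⟨m, hmN⟩ ⟨j, hj⟩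
  let X : (Fin N → ℕ) → ℕ → ℝ := fun x i => if h : i < N then (x ⟨i, h⟩ : ℝ) else 0
  let g : (Fin N → ℕ) → ℝ := fun x => (X x 0) ^ 2 * (∏ i ∈ Finset.Ico 1 m, X x i) * X x m
  have hg : Measurable g := measurable_of_countable g
  have hm1' : ∀ i : ℕ, Measurable (fun ω => ν ω i) := fun i =>
    (measurable_pi_apply i).comp hνmeas
  have hA : Measurable (fun ω => fun i : Fin N => ν ω (π i)) :=
    measurable_pi_lambda _ fun i => hm1' _
  have hB : Measurable (fun ω => fun i : Fin N => ν ω i) :=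
    measurable_pi_lambda _ fun i => hm1' _
  have e1 := integral_map (μ := P) hA.aemeasurable (f := g) hg.aestronglyMeasurable
  have e2 := integral_map (μ := P) hB.aemeasurable (f := g) hg.aestronglyMeasurable
  rw [hexch π, e2] at e1
  have hfix : ∀ i (h : i < N), i < m → ((π ⟨i, h⟩ : Fin N) : ℕ) = i := by
    intro i h him
    have : π ⟨i, h⟩ = ⟨i, h⟩ := Equiv.swap_apply_of_ne_of_ne
      (by simp only [ne_eq, Fin.mk.injEq]; omega) (by simp only [ne_eq, Fin.mk.injEq]; omega)
    rw [this]
  have hpm : ((π ⟨m, hmN⟩ : Fin N) : ℕ) = j := by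
    have : π ⟨m, hmN⟩ = ⟨j, hj⟩ := Equiv.swap_apply_left _ _
    rw [this]
  have c1 : ∀ ω, g (fun i : Fin N => ν ω (π i)) =
      ((ν ω 0 : ℝ)) ^ 2 * (∏ i ∈ Finset.Ico 1 m, (ν ω i : ℝ)) * (ν ω j : ℝ) := by
    intro ω
    have h0 : 0 < N := by omega
    have : ∀ i ∈ Finset.Ico 1 m, X (fun i : Fin N => ν ω (π i)) i = (ν ω i : ℝ) := by
      intro i hi
      have hi := Finset.mem_Ico.1 hi
      have h : i < N := by omega
      simp only [X, h, dif_pos, hfix i h hi.2]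
    simp only [g]
    rw [Finset.prod_congr rfl this]
    simp only [X, h0, hmN, dif_pos, hpm, hfix 0 h0 (by omega)]
  have c2 : ∀ ω, g (fun i : Fin N => ν ω i) =
      ((ν ω 0 : ℝ)) ^ 2 * (∏ i ∈ Finset.Ico 1 m, (ν ω i : ℝ)) * (ν ω m : ℝ) := by
    intro ω
    have h0 : 0 < N := by omega
    have : ∀ i ∈ Finset.Ico 1 m, X (fun i : Fin N => ν ω i) i = (ν ω i : ℝ) := by
      intro i hi
      have hi := Finset.mem_Ico.1 hi
      have h : i < N := by omega
      simp only [X, h, dif_pos]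
    simp only [g]
    rw [Finset.prod_congr rfl this]
    simp only [X, h0, hmN, dif_pos]
  simp only [c1, c2] at e1
  exact e1.symm

/-- For an exchangeable vector `(ν_1,…,ν_N)` of nonnegative integers with
`ν_1 + ⋯ + ν_N = N'` a.s. (`N ≥ 2`, `N' ≥ 1`), and every `1 ≤ m ≤ N`:
`E[ν_1² ν_2 ⋯ ν_m] ≤ ((N')^{m−1} / (N−1)_{m−1}) · E[ν_1²]`,
where `(N−1)_{m−1}` is the falling factorial (equal to `1` when `m = 1`).
(Indices of `ν` are shifted to be `0`-based: `ν_1² ν_2 ⋯ ν_m` is `(ν 0)² ·` the product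
over `Ico 1 m`.) -/
theorem exchangeable_sq_product_moment_le
    {Ω : Type*} [MeasurableSpace Ω] (P : Measure Ω) [IsProbabilityMeasure P]
    (N N' : ℕ) (hN : 2 ≤ N) (hN' : 1 ≤ N')
    (ν : Ω → ℕ → ℕ) (hνmeas : Measurable ν)
    (hsum : ∀ᵐ ω ∂P, ∑ i ∈ Finset.range N, ν ω i = N')
    (hexch : ∀ π : Equiv.Perm (Fin N),
      Measure.map (fun ω => fun i : Fin N => ν ω (π i)) P
        = Measure.map (fun ω => fun i : Fin N => ν ω i) P)
    (m : ℕ) (hm1 : 1 ≤ m) (hmN : m ≤ N) :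
    (∫ ω, ((ν ω 0 : ℝ)) ^ 2 * ∏ i ∈ Finset.Ico 1 m, (ν ω i : ℝ) ∂P)
      ≤ (((N' : ℝ)) ^ (m - 1) / ((N - 1).descFactorial (m - 1) : ℝ))
          * ∫ ω, ((ν ω 0 : ℝ)) ^ 2 ∂P := by
  induction m, hm1 using Nat.le_induction with
  | base => simp
  | succ m hm1 ih =>
    have ih := ih (by omega)
    have hI := aux_integrable P N N' hN ν hνmeas hsum m
    have hI0 := hI 0 (by omega) (by omega) 0
    have hI1 := fun j hj => hI j (by omega) hj 1
    simp only [pow_zero, mul_one, pow_one] at hI0 hI1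
    have key : ((N - m : ℕ) : ℝ) *
        ∫ ω, ((ν ω 0 : ℝ)) ^ 2 * (∏ i ∈ Finset.Ico 1 m, (ν ω i : ℝ)) * (ν ω m : ℝ) ∂P
        ≤ N' * ∫ ω, ((ν ω 0 : ℝ)) ^ 2 * ∏ i ∈ Finset.Ico 1 m, (ν ω i : ℝ) ∂P := by
      have h1 : ((N - m : ℕ) : ℝ) *
        ∫ ω, ((ν ω 0 : ℝ)) ^ 2 * (∏ i ∈ Finset.Ico 1 m, (ν ω i : ℝ)) * (ν ω m : ℝ) ∂P
        = ∑ j ∈ Finset.Ico m N,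
          ∫ ω, ((ν ω 0 : ℝ)) ^ 2 * (∏ i ∈ Finset.Ico 1 m, (ν ω i : ℝ)) * (ν ω j : ℝ) ∂P := by
        rw [Finset.sum_congr rfl fun j hj => aux_swap P N ν hνmeas hexch m j hm1
          (Finset.mem_Ico.1 hj).1 (Finset.mem_Ico.1 hj).2]
        simp
      rw [h1, ← integral_finsetSum _ fun j hj => hI1 j (Finset.mem_Ico.1 hj).2,
        ← integral_const_mul]
      refine integral_mono_ae (integrable_finsetSum _ fun j hj => hI1 j (Finset.mem_Ico.1 hj).2)
        (hI0.const_mul _) ?_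
      filter_upwards [hsum] with ω hω
      have h2 : ∑ j ∈ Finset.Ico m N, (ν ω j : ℝ) ≤ N' := by
        rw [← hω]
        push_cast
        refine Finset.sum_le_sum_of_subset_of_nonneg ?_ fun _ _ _ => by positivity
        intro j hj
        exact Finset.mem_range.2 (Finset.mem_Ico.1 hj).2
      simp only [← Finset.mul_sum]
      rw [mul_comm]
      gcongr
    simp only [Finset.prod_Ico_succ_top hm1, ← mul_assoc]
    obtain ⟨k, rfl⟩ : ∃ k, m = k + 1 := ⟨m - 1, by omega⟩
    simp only [Nat.add_sub_cancel] at ih ⊢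
    rw [Nat.descFactorial_succ, show N - 1 - k = N - (k + 1) by omega]
    have hpos : (0 : ℝ) < ((N - (k + 1) : ℕ) : ℝ) := by
      exact_mod_cast (by omega : 0 < N - (k + 1))
    have key2 := key.trans (mul_le_mul_of_nonneg_left ih (Nat.cast_nonneg N'))
    rw [mul_comm, ← le_div_iff₀ hpos] at key2
    refine key2.trans (le_of_eq ?_)
    push_cast
    rw [pow_succ]
    field_simp
end
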